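/- arXiv:2301.08039 — 4 statements merged into one kernel-verified Lean document; each statement's English description precedes it below -/
import Mathlib

section
/- Under Assumptions (A1)–(A2) with u ≥ 0, for every β > 0 the measure μ_β satisfies ∫_{ℝ^d} |x|² dμ_β(x) ≤ (2/m)(u(0) + d/β), and consequently ∫_{ℝ^d} |x| dμ_β(x) ≤ √((2/m)(u(0) + d/β)). -/
open MeasureTheory Real

local notation "⟪" x ", " y "⟫" => @inner ℝ _ _ x y

/-- A function on an inner product space whose gradient is `2m`-strongly monotone is `m`-strongly
convex along rays from the origin. -/
theorem le_of_gradient_strongly_monotone {E : Type*} [NormedAddCommGroup E]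
    [InnerProductSpace ℝ E] [CompleteSpace E] {m : ℝ} {u : E → ℝ} (hu : Differentiable ℝ u)
    (hmono : ∀ x y : E, 2 * m * ‖x - y‖ ^ 2 ≤ inner ℝ (gradient u x - gradient u y) (x - y))
    (x : E) {t : ℝ} (ht0 : 0 ≤ t) (ht1 : t ≤ 1) :
    u (t • x) ≤ t * u x + (1 - t) * u 0 - m * t * (1 - t) * ‖x‖ ^ 2 := by
  have hderiv : ∀ s : ℝ, HasDerivAt (fun s : ℝ => u (s • x) - m * s ^ 2 * ‖x‖ ^ 2)
      (inner ℝ (gradient u (s • x)) x - 2 * m * s * ‖x‖ ^ 2) s := by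
    intro s
    have h1 : HasDerivAt (fun s : ℝ => s • x) x s := by
      simpa using (hasDerivAt_id s).smul_const x
    have h2 := (hu (s • x)).hasGradientAt.hasFDerivAt.comp_hasDerivAt s h1
    have h3 := ((hasDerivAt_pow 2 s).const_mul m).mul_const (‖x‖ ^ 2)
    refine (h2.sub h3).congr_deriv ?_
    rw [InnerProductSpace.toDual_apply_apply]
    push_cast
    ring
  have hmonotone : Monotone (deriv fun s : ℝ => u (s • x) - m * s ^ 2 * ‖x‖ ^ 2) := by
    intro a b hab
    rw [(hderiv a).deriv, (hderiv b).deriv]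
    rcases hab.eq_or_lt with rfl | hlt
    · exact le_rfl
    have h := hmono (b • x) (a • x)
    rw [← sub_smul, norm_smul, inner_smul_right, inner_sub_left, mul_pow, Real.norm_eq_abs,
      sq_abs] at h
    have h' : 2 * m * (b - a) * ‖x‖ ^ 2
        ≤ inner ℝ (gradient u (b • x)) x - inner ℝ (gradient u (a • x)) x := by
      refine le_of_mul_le_mul_left ?_ (sub_pos.2 hlt)
      linarith
    linarith
  have hconv := hmonotone.convexOn_univ_of_deriv fun s => (hderiv s).differentiableAt
  have h := hconv.2 (Set.mem_univ 1) (Set.mem_univ 0) ht0 (sub_nonneg.2 ht1) (by ring)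
  simp only [smul_eq_mul, mul_one, mul_zero, add_zero, one_smul, zero_smul] at h
  linarith

/-- Second moment of a probability density `c * exp (-β u)` on a `d`-dimensional space when `u` is
nonnegative and `m`-strongly convex along rays from the origin. -/
theorem integrable_and_integral_norm_sq_le {E : Type*} [NormedAddCommGroup E] [NormedSpace ℝ E]
    [FiniteDimensional ℝ E] [MeasurableSpace E] [BorelSpace E] (ν : Measure E)
    [ν.IsAddHaarMeasure] {m β c : ℝ} (hm : 0 < m) (hβ : 0 < β) (hc : 0 < c) {u : E → ℝ}
    (hu : Continuous u) (hnonneg : ∀ x, 0 ≤ u x)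
    (hconv : ∀ (x : E) (t : ℝ), 0 ≤ t → t ≤ 1 →
      u (t • x) ≤ t * u x + (1 - t) * u 0 - m * t * (1 - t) * ‖x‖ ^ 2)
    (hint : Integrable (fun x => c * exp (-β * u x)) ν)
    (hone : ∫ x, c * exp (-β * u x) ∂ν = 1) :
    Integrable (fun x => c * exp (-β * u x) * ‖x‖ ^ 2) ν ∧
      m * ∫ x, c * exp (-β * u x) * ‖x‖ ^ 2 ∂ν ≤ u 0 + Module.finrank ℝ E / β := by
  set p : E → ℝ := fun x => c * exp (-β * u x) with hp
  have hp0 : ∀ x, 0 ≤ p x := fun x => by positivity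
  have hpoint : ∀ (x : E) (t : ℝ), 0 ≤ t → t ≤ 1 →
      p x + β * (1 - t) * (m * t * (p x * ‖x‖ ^ 2) - u 0 * p x) ≤ p (t • x) := by
    intro x t ht0 ht1
    have hs := sub_nonneg.2 ht1
    have h1 : -β * u x + β * (1 - t) * (m * t * ‖x‖ ^ 2 - u 0) ≤ -β * u (t • x) := by
      have h2 := mul_le_mul_of_nonneg_left (hconv x t ht0 ht1) hβ.le
      have h3 : 0 ≤ β * (1 - t) * u x := mul_nonneg (mul_nonneg hβ.le hs) (hnonneg x)
      linarith
    have h2 := exp_le_exp.2 h1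
    rw [exp_add] at h2
    have h3 := add_one_le_exp (β * (1 - t) * (m * t * ‖x‖ ^ 2 - u 0))
    have h4 := mul_le_mul_of_nonneg_left h3 (hp0 x)
    have h5 := mul_le_mul_of_nonneg_left h2 hc.le
    simp only [hp] at h4 ⊢
    linarith
  have hintsq : Integrable (fun x => p x * ‖x‖ ^ 2) ν := by
    have hhalf : Integrable (fun x => p ((1 / 2 : ℝ) • x)) ν := hint.comp_smul (by norm_num)
    have hbound : Integrable
        (fun x => 4 / (β * m) * (p ((1 / 2 : ℝ) • x) + β * u 0 / 2 * p x)) ν :=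
      (hhalf.add (hint.const_mul _)).const_mul _
    refine hbound.mono' (by fun_prop) (Filter.Eventually.of_forall fun x => ?_)
    rw [norm_of_nonneg (mul_nonneg (hp0 x) (by positivity)), div_mul_eq_mul_div,
      le_div_iff₀ (by positivity)]
    have h := hpoint x (1 / 2) (by norm_num) (by norm_num)
    linarith [hp0 x]
  refine ⟨hintsq, ?_⟩
  change m * ∫ x, p x * ‖x‖ ^ 2 ∂ν ≤ _
  clear_value p
  set I := ∫ x, p x * ‖x‖ ^ 2 ∂ν with hI
  set n := Module.finrank ℝ E with hn
  have hscale : ∀ t : ℝ, 0 < t → t < 1 → β * t ^ n * (m * t * I - u 0) ≤ n := by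
    intro t ht0 ht1
    have htn : 0 < t ^ n := pow_pos ht0 n
    have hcomp : ∫ x, p (t • x) ∂ν = (t ^ n)⁻¹ := by
      rw [Measure.integral_comp_smul, hone, smul_eq_mul, mul_one, abs_of_pos (inv_pos.2 htn)]
    have hdiff : Integrable (fun x => m * t * (p x * ‖x‖ ^ 2) - u 0 * p x) ν :=
      (hintsq.const_mul _).sub (hint.const_mul _)
    have hmono := integral_mono (μ := ν) (hint.add (hdiff.const_mul (β * (1 - t))))
      (hint.comp_smul ht0.ne') fun x => hpoint x t ht0.le ht1.le
    simp only [Pi.add_apply] at hmono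
    rw [hcomp, integral_add hint (hdiff.const_mul _), integral_const_mul,
      integral_sub (hintsq.const_mul _) (hint.const_mul _), integral_const_mul,
      integral_const_mul, hone, ← hI] at hmono
    have h1 := mul_le_mul_of_nonneg_left hmono htn.le
    rw [mul_inv_cancel₀ htn.ne'] at h1
    have h2 := one_add_mul_le_pow (a := t - 1) (by linarith) n
    rw [add_sub_cancel] at h2
    refine le_of_mul_le_mul_left ?_ (sub_pos.2 ht1)
    linarith
  have hcont : Continuous fun t : ℝ => β * t ^ n * (m * t * I - u 0) := by fun_prop
  have hlim := (hcont.tendsto 1).mono_left (nhdsWithin_le_nhds (s := Set.Iio 1))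
  have hle := le_of_tendsto hlim (Filter.mem_of_superset
    (Ioo_mem_nhdsLT (zero_lt_one' ℝ)) fun t ht => hscale t ht.1 ht.2)
  rw [one_pow, mul_one, mul_one] at hle
  have := (le_div_iff₀' hβ).2 hle
  linarith

/-- The mean of a function with respect to a probability measure is at most its `L²` norm. -/
theorem integral_le_sqrt_integral_sq {Ω : Type*} [MeasurableSpace Ω] {μ : Measure Ω}
    [IsProbabilityMeasure μ] {f : Ω → ℝ} (hf : AEStronglyMeasurable f μ)
    (hf2 : Integrable (fun x => f x ^ 2) μ) :
    ∫ x, f x ∂μ ≤ √(∫ x, f x ^ 2 ∂μ) := by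
  have h := ProbabilityTheory.variance_eq_sub ((memLp_two_iff_integrable_sq hf).2 hf2)
  have h0 := ProbabilityTheory.variance_nonneg f μ
  refine le_sqrt_of_sq_le ?_
  simp only [Pi.pow_apply] at h
  linarith

theorem stmt_2 (d : ℕ) (hd : 1 ≤ d) (m L l β : ℝ)
    (hm : 0 < m) (hL : 0 < L) (hl : 0 < l) (hβ : 0 < β)
    (u : EuclideanSpace ℝ (Fin d) → ℝ) (hu : ContDiff ℝ 2 u)
    (hnonneg : ∀ x, 0 ≤ u x)
    (hA1 : ∀ x y : EuclideanSpace ℝ (Fin d),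
      ⟪gradient u x - gradient u y, x - y⟫ ≥ 2 * m * ‖x - y‖ ^ 2)
    (hA2 : ∀ x y : EuclideanSpace ℝ (Fin d),
      ‖gradient u x - gradient u y‖ ≤ L * (1 + ‖x‖ + ‖y‖) ^ l * ‖x - y‖)
    (μ : Measure (EuclideanSpace ℝ (Fin d))) (hprob : IsProbabilityMeasure μ)
    (hμ : ∃ c : ℝ, 0 < c ∧ μ = volume.withDensity
      (fun x => ENNReal.ofReal (c * Real.exp (-β * u x)))) :
    (∫ x, ‖x‖ ^ 2 ∂μ ≤ 2 / m * (u 0 + d / β)) ∧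
    (∫ x, ‖x‖ ∂μ ≤ Real.sqrt (2 / m * (u 0 + d / β))) := by
  obtain ⟨c, hc, rfl⟩ := hμ
  have hcont : Continuous u := hu.continuous
  have hp0 : ∀ x, 0 ≤ c * exp (-β * u x) := fun x => by positivity
  have hpc : Continuous fun x => c * exp (-β * u x) := by fun_prop
  have hmass : ∫⁻ x, ENNReal.ofReal (c * exp (-β * u x)) = 1 := by
    simpa using hprob.measure_univ
  have hint : Integrable fun x => c * exp (-β * u x) :=
    (lintegral_ofReal_ne_top_iff_integrable hpc.aestronglyMeasurable
      (Filter.Eventually.of_forall hp0)).1 (hmass ▸ ENNReal.one_ne_top)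
  have hone : ∫ x, c * exp (-β * u x) = 1 := by
    rw [integral_eq_lintegral_of_nonneg_ae (Filter.Eventually.of_forall hp0)
      hpc.aestronglyMeasurable, hmass, ENNReal.toReal_one]
  obtain ⟨hintsq, hle⟩ := integrable_and_integral_norm_sq_le volume hm hβ hc hcont hnonneg
    (fun x t => le_of_gradient_strongly_monotone (hu.differentiable (by norm_num)) hA1 x)
    hint hone
  rw [finrank_euclideanSpace_fin] at hle
  have hmeas : Measurable fun x => ENNReal.ofReal (c * exp (-β * u x)) :=
    hpc.measurable.ennreal_ofReal
  have hfin : ∀ᵐ x, ENNReal.ofReal (c * exp (-β * u x)) < ⊤ :=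
    Filter.Eventually.of_forall fun _ => ENNReal.ofReal_lt_top
  have hsq : Integrable (fun x => ‖x‖ ^ 2)
      (volume.withDensity fun x => ENNReal.ofReal (c * exp (-β * u x))) := by
    rw [integrable_withDensity_iff hmeas hfin]
    simpa only [ENNReal.toReal_ofReal (hp0 _), mul_comm (‖_‖ ^ 2)] using hintsq
  have hmoment : ∫ x, ‖x‖ ^ 2
      ∂(volume.withDensity fun x => ENNReal.ofReal (c * exp (-β * u x)))
      ≤ 2 / m * (u 0 + d / β) := by
    rw [integral_withDensity_eq_integral_toReal_smul hmeas hfin]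
    simp only [ENNReal.toReal_ofReal (hp0 _), smul_eq_mul]
    have hB : 0 ≤ u 0 + d / β := add_nonneg (hnonneg 0) (by positivity)
    rw [div_mul_eq_mul_div, le_div_iff₀ hm]
    linarith
  exact ⟨hmoment, (integral_le_sqrt_integral_sq (by fun_prop) hsq).trans
    (sqrt_le_sqrt hmoment)⟩
end

section
/- Under Assumptions (A1)–(A2) with u ≥ 0, for every real p ≥ 2 and every β > 0, ∫_{ℝ^d} |x|^p dμ_β(x) ≤ 2^{p−1} [ (d/(βm))^{p/2} (1 + p/d)^{p/2 − 1} + ((2/m)(u(0) + d/β))^{p/2} ]. -/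
open MeasureTheory Real

local notation "⟪" x ", " y "⟫" => @inner ℝ _ _ x y

open Filter Topology

/-- A function with `2m`-strongly monotone gradient is strongly convex along rays from the origin. -/
lemma apply_smul_le_of_strongly_monotone_gradient {E : Type*} [NormedAddCommGroup E]
    [InnerProductSpace ℝ E] [CompleteSpace E] {u : E → ℝ} {m : ℝ} (hu : Differentiable ℝ u)
    (hmono : ∀ x y : E, ⟪gradient u x - gradient u y, x - y⟫ ≥ 2 * m * ‖x - y‖ ^ 2)
    (x : E) {s : ℝ} (hs0 : 0 ≤ s) (hs1 : s ≤ 1) :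
    u (s • x) ≤ s * u x + (1 - s) * u 0 - m * s * (1 - s) * ‖x‖ ^ 2 := by
  have hderiv (t : ℝ) : HasDerivAt (fun t : ℝ => u (t • x) - m * t ^ 2 * ‖x‖ ^ 2)
      (⟪gradient u (t • x), x⟫ - 2 * m * t * ‖x‖ ^ 2) t := by
    have h1 : HasDerivAt (fun t : ℝ => t • x) x t := by
      simpa using (hasDerivAt_id t).smul_const x
    have h2 := (hu (t • x)).hasGradientAt.hasFDerivAt.comp_hasDerivAt t h1
    have h3 := (((hasDerivAt_pow 2 t).const_mul m).mul_const (‖x‖ ^ 2))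
    refine (h2.sub h3).congr_deriv ?_
    simp only [InnerProductSpace.toDual_apply_apply]
    push_cast
    ring
  have hconv : ConvexOn ℝ Set.univ (fun t : ℝ => u (t • x) - m * t ^ 2 * ‖x‖ ^ 2) := by
    refine Monotone.convexOn_univ_of_deriv (fun t => (hderiv t).differentiableAt) ?_
    intro a b hab
    rw [(hderiv a).deriv, (hderiv b).deriv]
    rcases hab.eq_or_lt with rfl | hab
    · rfl
    have h := hmono (b • x) (a • x)
    rw [← sub_smul, inner_smul_right, norm_smul, inner_sub_left, mul_pow, Real.norm_eq_abs,
      sq_abs] at h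
    have hpos : 0 < b - a := sub_pos.2 hab
    have h' : 2 * m * (b - a) * ‖x‖ ^ 2 ≤ ⟪gradient u (b • x), x⟫ - ⟪gradient u (a • x), x⟫ := by
      refine le_of_mul_le_mul_left ?_ hpos
      linarith
    linarith
  have h := hconv.2 (Set.mem_univ 0) (Set.mem_univ 1) (sub_nonneg.2 hs1) hs0 (by ring)
  simp only [smul_eq_mul, mul_zero, mul_one, zero_add, zero_smul, one_smul] at h
  norm_num at h
  linarith

lemma le_of_forall_rpow_neg_lower_bound {A B D b m v : ℝ}
    (h : ∀ s : ℝ, 0 < s → s < 1 →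
      B + b * (1 - s) * (m * s * A - v * B) ≤ s ^ (-D) * B) :
    b * (m * A - v * B) ≤ D * B := by
  have hd : HasDerivAt (fun s : ℝ => s ^ (-D) * B) (-D * B) 1 := by
    simpa using (Real.hasDerivAt_rpow_const (x := 1) (p := -D) (Or.inl one_ne_zero)).mul_const B
  have hslope := (hasDerivWithinAt_iff_tendsto_slope' (s := Set.Iio (1 : ℝ)) (by simp)).1
    hd.hasDerivWithinAt
  have hlim : Tendsto (fun s : ℝ => -(b * (m * s * A - v * B))) (𝓝[<] 1)
      (𝓝 (-(b * (m * 1 * A - v * B)))) :=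
    (Continuous.tendsto (by fun_prop) 1).mono_left nhdsWithin_le_nhds
  have hle := le_of_tendsto_of_tendsto hslope hlim (by
    filter_upwards [Ioo_mem_nhdsLT (zero_lt_one (α := ℝ))] with s hs
    have := h s hs.1 hs.2
    rw [slope_def_field, div_le_iff_of_neg (by linarith [hs.2])]
    simp only [Real.one_rpow]
    linarith)
  linarith

/-- Recursion between the moments of a density proportional to `exp (-β u)`, for `u` strongly convex
along rays from the origin. -/
lemma moment_recursion {E : Type*} [NormedAddCommGroup E]
    [NormedSpace ℝ E] [FiniteDimensional ℝ E] [MeasurableSpace E] [BorelSpace E]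
    (ν : Measure E) [ν.IsAddHaarMeasure] {u : E → ℝ} {m β c q : ℝ}
    (hβ : 0 < β) (hc : 0 < c) (hq : 0 ≤ q) (hnonneg : ∀ x, 0 ≤ u x)
    (hconv : ∀ x : E, ∀ s : ℝ, 0 < s → s < 1 →
      u (s • x) ≤ s * u x + (1 - s) * u 0 - m * s * (1 - s) * ‖x‖ ^ 2)
    (hB : Integrable (fun x => c * Real.exp (-β * u x) * ‖x‖ ^ q) ν)
    (hA : Integrable (fun x => c * Real.exp (-β * u x) * ‖x‖ ^ (q + 2)) ν) :
    β * (m * (∫ x, c * Real.exp (-β * u x) * ‖x‖ ^ (q + 2) ∂ν)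
        - u 0 * ∫ x, c * Real.exp (-β * u x) * ‖x‖ ^ q ∂ν) ≤
      (Module.finrank ℝ E + q) * ∫ x, c * Real.exp (-β * u x) * ‖x‖ ^ q ∂ν := by
  refine le_of_forall_rpow_neg_lower_bound fun s hs0 hs1 => ?_
  have hscale (x : E) : c * Real.exp (-β * u (s • x)) * ‖s • x‖ ^ q =
      s ^ q * (c * Real.exp (-β * u (s • x)) * ‖x‖ ^ q) := by
    rw [norm_smul, Real.norm_of_nonneg hs0.le, Real.mul_rpow hs0.le (norm_nonneg x)]
    ring
  have hint : Integrable (fun x => s ^ (-q) *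
      (c * Real.exp (-β * u (s • x)) * ‖s • x‖ ^ q)) ν :=
    ((integrable_comp_smul_iff ν
      (fun x => c * Real.exp (-β * u x) * ‖x‖ ^ q) hs0.ne').2 hB).const_mul _
  have hpt (x : E) : c * Real.exp (-β * u x) * ‖x‖ ^ q
      + β * (1 - s) * (m * s * (c * Real.exp (-β * u x) * ‖x‖ ^ (q + 2))
        - u 0 * (c * Real.exp (-β * u x) * ‖x‖ ^ q)) ≤
      s ^ (-q) * (c * Real.exp (-β * u (s • x)) * ‖s • x‖ ^ q) := by
    have hss : s ^ (-q) * s ^ q = 1 := by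
      rw [← Real.rpow_add hs0, neg_add_cancel, Real.rpow_zero]
    rw [hscale, ← mul_assoc (s ^ (-q)), hss, one_mul, Real.rpow_add_of_nonneg (norm_nonneg x) hq zero_le_two,
      Real.rpow_two]
    set r := β * (1 - s) * (m * s * ‖x‖ ^ 2 - u 0)
    have hr : r + 1 ≤ Real.exp (β * (u x - u (s • x))) := by
      refine (Real.add_one_le_exp r).trans (Real.exp_le_exp.2 ?_)
      have h1 := hconv x s hs0 hs1
      have h2 : 0 ≤ (1 - s) * u x := mul_nonneg (by linarith) (hnonneg x)
      have h3 : (1 - s) * (m * s * ‖x‖ ^ 2 - u 0) ≤ u x - u (s • x) := by linarith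
      simpa only [r, mul_assoc] using mul_le_mul_of_nonneg_left h3 hβ.le
    have hexp : Real.exp (-β * u (s • x)) =
        Real.exp (-β * u x) * Real.exp (β * (u x - u (s • x))) := by
      rw [← Real.exp_add]; congr 1; ring
    have hw : 0 ≤ c * Real.exp (-β * u x) * ‖x‖ ^ q := by positivity
    have h := mul_le_mul_of_nonneg_left hr hw
    rw [hexp]
    simp only [r] at h
    linarith
  have hlow : Integrable (fun x => β * (1 - s) *
      (m * s * (c * Real.exp (-β * u x) * ‖x‖ ^ (q + 2))
        - u 0 * (c * Real.exp (-β * u x) * ‖x‖ ^ q))) ν :=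
    ((hA.const_mul _).sub (hB.const_mul _)).const_mul _
  have h := integral_mono (hB.add hlow) hint hpt
  simp only [Pi.add_apply] at h
  rw [integral_add hB hlow, integral_const_mul, integral_sub (hA.const_mul _) (hB.const_mul _),
    integral_const_mul, integral_const_mul, integral_const_mul,
    Measure.integral_comp_smul ν (fun x => c * Real.exp (-β * u x) * ‖x‖ ^ q) s,
    abs_of_nonneg (by positivity), smul_eq_mul] at h
  refine h.trans_eq ?_
  rw [neg_add, Real.rpow_add hs0, Real.rpow_neg hs0.le (Module.finrank ℝ E : ℝ), Real.rpow_natCast]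
  ring

lemma integral_rpow_le_of_moment_recursion {Ω : Type*} [MeasurableSpace Ω] {μ : Measure Ω}
    [IsProbabilityMeasure μ] {f : Ω → ℝ} (hf : ∀ x, 0 ≤ f x) {p K : ℝ} (hp : 2 ≤ p) (hK : 0 ≤ K)
    (hint : Integrable (fun x => f x ^ p) μ) (hint' : Integrable (fun x => f x ^ (p - 2)) μ)
    (h : ∫ x, f x ^ p ∂μ ≤ K * ∫ x, f x ^ (p - 2) ∂μ) :
    ∫ x, f x ^ p ∂μ ≤ K ^ (p / 2) := by
  have hp0 : 0 < p := by linarith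
  have hpt (x : Ω) : K * f x ^ (p - 2) ≤ 2 / p * K ^ (p / 2) + (1 - 2 / p) * f x ^ p := by
    have hw : 0 ≤ 1 - 2 / p := by
      rw [sub_nonneg, div_le_one hp0]; exact hp
    have := Real.geom_mean_le_arith_mean2_weighted (w₁ := 2 / p) (w₂ := 1 - 2 / p)
      (by positivity) hw (Real.rpow_nonneg hK (p / 2)) (Real.rpow_nonneg (hf x) p) (by ring)
    rwa [← Real.rpow_mul hK, ← Real.rpow_mul (hf x), show p / 2 * (2 / p) = 1 by field_simp,
      show p * (1 - 2 / p) = p - 2 by field_simp, Real.rpow_one] at this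
  have hi := integral_mono (hint'.const_mul K)
    ((integrable_const (2 / p * K ^ (p / 2))).add (hint.const_mul (1 - 2 / p))) hpt
  simp only [Pi.add_apply] at hi
  rw [integral_add (integrable_const _) (hint.const_mul _), integral_const_mul,
    integral_const_mul (1 - 2 / p), integral_const, probReal_univ, one_smul] at hi
  have h2 : 2 / p * ∫ x, f x ^ p ∂μ ≤ 2 / p * K ^ (p / 2) := by linarith
  exact le_of_mul_le_mul_left h2 (by positivity)

lemma Real.add_rpow_le_two_rpow_mul {a b q : ℝ} (ha : 0 ≤ a) (hb : 0 ≤ b) (hq : 1 ≤ q) :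
    (a + b) ^ q ≤ 2 ^ (q - 1) * (a ^ q + b ^ q) := by
  lift a to NNReal using ha
  lift b to NNReal using hb
  exact_mod_cast NNReal.rpow_add_le_mul_rpow_add_rpow a b hq

lemma two_mul_sub_one_le_two_rpow {q : ℝ} (hq : 1 ≤ q) : 2 * q - 1 ≤ (2 : ℝ) ^ q := by
  have h1 : (2 : ℝ) ^ q = 4 * Real.exp (Real.log 2 * (q - 2)) := by
    rw [← Real.rpow_def_of_pos zero_lt_two, Real.rpow_sub zero_lt_two, Real.rpow_two]
    ring
  have h2 := Real.add_one_le_exp (Real.log 2 * (q - 2))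
  have h3 := Real.log_two_gt_d9
  have h4 := Real.log_two_lt_d9
  nlinarith

lemma moment_constant_le {d k b v q : ℝ} (hd : 1 ≤ d) (hk : 0 < k) (hb : 0 ≤ b) (hbv : b ≤ v)
    (hq : 1 ≤ q) :
    ((d + 2 * q - 2) / k + b) ^ q ≤
      2 ^ (2 * q - 1) * ((d / k) ^ q * (1 + 2 * q / d) ^ (q - 1) + v ^ q) := by
  have hd0 : 0 < d := by linarith
  set a := (d + 2 * q - 2) / k with ha_def
  have ha : 0 < a := div_pos (by linarith) hk
  have htwo := two_mul_sub_one_le_two_rpow hq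
  have ha1 : a ≤ 2 ^ q * (d / k) := by
    rw [ha_def, ← mul_div_assoc]
    gcongr
    nlinarith
  have ha2 : a ≤ d / k * (1 + 2 * q / d) := by
    rw [show d / k * (1 + 2 * q / d) = (d + 2 * q) / k by field_simp, ha_def]
    gcongr
    linarith
  have haq : a ^ q ≤ 2 ^ q * ((d / k) ^ q * (1 + 2 * q / d) ^ (q - 1)) := by
    have hdk : 0 < d / k := div_pos hd0 hk
    calc a ^ q = a * a ^ (q - 1) := by
          rw [← Real.rpow_one_add' ha.le (by linarith)]; congr 1; ring
      _ ≤ (2 ^ q * (d / k)) * (d / k * (1 + 2 * q / d)) ^ (q - 1) := by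
          gcongr
      _ = 2 ^ q * ((d / k) ^ q * (1 + 2 * q / d) ^ (q - 1)) := by
          rw [Real.mul_rpow hdk.le (by positivity)]
          have h : (d / k) ^ q = d / k * (d / k) ^ (q - 1) := by
            rw [← Real.rpow_one_add' hdk.le (by linarith)]; congr 1; ring
          rw [h]
          ring
  have hbq : b ^ q ≤ 2 ^ q * v ^ q := by
    have h1 : b ^ q ≤ v ^ q := Real.rpow_le_rpow hb hbv (by linarith)
    have h2 : 0 ≤ v ^ q := Real.rpow_nonneg (hb.trans hbv) q
    nlinarith
  calc (a + b) ^ q ≤ 2 ^ (q - 1) * (a ^ q + b ^ q) := Real.add_rpow_le_two_rpow_mul ha.le hb hq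
    _ ≤ 2 ^ (q - 1) * (2 ^ q * ((d / k) ^ q * (1 + 2 * q / d) ^ (q - 1)) + 2 ^ q * v ^ q) := by
        gcongr
    _ = _ := by
        rw [show 2 * q - 1 = (q - 1) + q by ring, Real.rpow_add zero_lt_two]
        ring

theorem stmt_3 (d : ℕ) (hd : 1 ≤ d) (m L l β : ℝ)
    (hm : 0 < m) (hL : 0 < L) (hl : 0 < l) (hβ : 0 < β)
    (u : EuclideanSpace ℝ (Fin d) → ℝ) (hu : ContDiff ℝ 2 u)
    (hnonneg : ∀ x, 0 ≤ u x)
    (hA1 : ∀ x y : EuclideanSpace ℝ (Fin d),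
      ⟪gradient u x - gradient u y, x - y⟫ ≥ 2 * m * ‖x - y‖ ^ 2)
    (hA2 : ∀ x y : EuclideanSpace ℝ (Fin d),
      ‖gradient u x - gradient u y‖ ≤ L * (1 + ‖x‖ + ‖y‖) ^ l * ‖x - y‖)
    (μ : Measure (EuclideanSpace ℝ (Fin d))) (hprob : IsProbabilityMeasure μ)
    (hμ : ∃ c : ℝ, 0 < c ∧ μ = volume.withDensity
      (fun x => ENNReal.ofReal (c * Real.exp (-β * u x)))) :
    ∀ p : ℝ, 2 ≤ p →
      ∫ x, ‖x‖ ^ p ∂μ ≤ 2 ^ (p - 1) *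
        ((d / (β * m)) ^ (p / 2) * (1 + p / d) ^ (p / 2 - 1) +
          (2 / m * (u 0 + d / β)) ^ (p / 2)) := by
  intro p hp
  have hd' : (1 : ℝ) ≤ d := by exact_mod_cast hd
  have hu0 := hnonneg 0
  have hβm : 0 < β * m := mul_pos hβ hm
  by_cases hint : Integrable (fun x => ‖x‖ ^ p) μ
  swap
  · rw [integral_undef hint]
    positivity
  have hint' : Integrable (fun x => ‖x‖ ^ (p - 2)) μ := by
    refine (hint.add (integrable_const 1)).mono' (by measurability) (.of_forall fun x => ?_)
    rw [Real.norm_of_nonneg (by positivity)]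
    simp only [Pi.add_apply]
    rcases le_total ‖x‖ 1 with hx | hx
    · have := Real.rpow_le_one (norm_nonneg x) hx (sub_nonneg.2 hp)
      have : 0 ≤ ‖x‖ ^ p := by positivity
      linarith
    · have := Real.rpow_le_rpow_of_exponent_le hx (by linarith : p - 2 ≤ p)
      linarith
  obtain ⟨c, hc, rfl⟩ := hμ
  have hmeas : Measurable fun x => ENNReal.ofReal (c * Real.exp (-β * u x)) := by
    have := hu.continuous.measurable
    fun_prop
  have hfin : ∀ᵐ x ∂(volume : Measure (EuclideanSpace ℝ (Fin d))),
      ENNReal.ofReal (c * Real.exp (-β * u x)) < ⊤ := .of_forall fun _ => ENNReal.ofReal_lt_top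
  have hw (x : EuclideanSpace ℝ (Fin d)) : (ENNReal.ofReal (c * Real.exp (-β * u x))).toReal =
      c * Real.exp (-β * u x) := ENNReal.toReal_ofReal (by positivity)
  have hA := (integrable_withDensity_iff_integrable_smul' hmeas hfin).1 hint
  have hB := (integrable_withDensity_iff_integrable_smul' hmeas hfin).1 hint'
  have hrec := moment_recursion (volume : Measure (EuclideanSpace ℝ (Fin d))) (u := u) (m := m)
    (q := p - 2) hβ hc (by linarith) hnonneg
    (fun x s hs0 hs1 => apply_smul_le_of_strongly_monotone_gradient
      (hu.differentiable two_ne_zero) hA1 x hs0.le hs1.le)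
    (by simpa only [hw, smul_eq_mul] using hB)
    (by simpa only [hw, smul_eq_mul, sub_add_cancel] using hA)
  have hbound := integral_rpow_le_of_moment_recursion (f := fun x => ‖x‖)
    (K := (d + 2 * (p / 2) - 2) / (β * m) + u 0 / m) (fun x => norm_nonneg x) hp
    (add_nonneg (div_nonneg (by linarith) hβm.le) (by positivity)) hint hint' (by
      simp only [integral_withDensity_eq_integral_toReal_smul hmeas hfin, hw, smul_eq_mul]
      simp only [finrank_euclideanSpace_fin, sub_add_cancel] at hrec
      refine le_of_mul_le_mul_left ?_ hβm
      rw [← mul_assoc (β * m), show β * m * ((d + 2 * (p / 2) - 2) / (β * m) + u 0 / m) =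
        d + (p - 2) + β * u 0 by field_simp; ring]
      linarith)
  refine hbound.trans ?_
  have hconst := moment_constant_le (d := d) (k := β * m) (b := u 0 / m)
    (v := 2 / m * (u 0 + d / β)) (q := p / 2) hd' hβm (by positivity)
    (by
      rw [div_mul_eq_mul_div]
      gcongr
      have : 0 ≤ d / β := by positivity
      linarith)
    (by linarith)
  rwa [show 2 * (p / 2) = p by ring] at hconst ⊢
end

section
/- Under Assumptions (A1)–(A2) with u ≥ 0 and β > 0, there exists a constant c̄ > 0 such that for every ε with 0 < ε < 1/m one has W₂(π_β, π_β^ε) ≤ c̄ ε. -/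
open MeasureTheory Real

local notation "⟪" x ", " y "⟫" => @inner ℝ _ _ x y

/-- The 2-Wasserstein distance between two measures on a normed space:
the square root of the infimum, over all couplings `Γ` of `μ` and `ν`,
of `∫ ‖x − y‖² dΓ(x,y)`. -/
noncomputable def W2 {E : Type*} [NormedAddCommGroup E] [MeasurableSpace E]
    (μ ν : MeasureTheory.Measure E) : ℝ :=
  Real.sqrt (⨅ Γ : {Γ : MeasureTheory.Measure (E × E) //
      Γ.map Prod.fst = μ ∧ Γ.map Prod.snd = ν},
    ∫ p : E × E, ‖p.1 - p.2‖ ^ 2 ∂(Γ : MeasureTheory.Measure (E × E)))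

open scoped ENNReal Topology
open Filter

section Coupling

variable {E : Type*} [MeasurableSpace E]

/-- The couplings of `μ` and `ν`. -/
def IsCoupling (μ ν : Measure E) (Γ : Measure (E × E)) : Prop :=
  Γ.map Prod.fst = μ ∧ Γ.map Prod.snd = ν

lemma IsCoupling.isProbabilityMeasure {μ ν : Measure E} [IsProbabilityMeasure μ]
    {Γ : Measure (E × E)} (h : IsCoupling μ ν Γ) : IsProbabilityMeasure Γ := by
  constructor
  have := measure_univ (μ := μ)
  rw [← h.1, Measure.map_apply measurable_fst MeasurableSet.univ] at this
  simpa using this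

lemma isCoupling_prod (μ ν : Measure E) [IsProbabilityMeasure μ] [IsProbabilityMeasure ν] :
    IsCoupling μ ν (μ.prod ν) := by
  constructor <;> simp

lemma IsCoupling.integrable_fst {μ ν : Measure E} {Γ : Measure (E × E)} (h : IsCoupling μ ν Γ)
    {φ : E → ℝ} (hφ : Integrable φ μ) : Integrable (fun p : E × E => φ p.1) Γ := by
  rw [← h.1] at hφ
  exact hφ.comp_measurable measurable_fst

lemma IsCoupling.integrable_snd {μ ν : Measure E} {Γ : Measure (E × E)} (h : IsCoupling μ ν Γ)
    {φ : E → ℝ} (hφ : Integrable φ ν) : Integrable (fun p : E × E => φ p.2) Γ := by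
  rw [← h.2] at hφ
  exact hφ.comp_measurable measurable_snd

lemma IsCoupling.integral_fst {μ ν : Measure E} {Γ : Measure (E × E)} (h : IsCoupling μ ν Γ)
    {φ : E → ℝ} (hφ : Integrable φ μ) : ∫ p, φ p.1 ∂Γ = ∫ x, φ x ∂μ := by
  rw [← h.1] at hφ ⊢
  exact (integral_map measurable_fst.aemeasurable hφ.1).symm

lemma IsCoupling.integral_snd {μ ν : Measure E} {Γ : Measure (E × E)} (h : IsCoupling μ ν Γ)
    {φ : E → ℝ} (hφ : Integrable φ ν) : ∫ p, φ p.2 ∂Γ = ∫ x, φ x ∂ν := by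
  rw [← h.2] at hφ ⊢
  exact (integral_map measurable_snd.aemeasurable hφ.1).symm

variable [NormedAddCommGroup E]

/-- The quadratic transport cost of a plan. -/
noncomputable def transportCost (Γ : Measure (E × E)) : ℝ :=
  ∫ p : E × E, ‖p.1 - p.2‖ ^ 2 ∂Γ

lemma transportCost_nonneg (Γ : Measure (E × E)) : 0 ≤ transportCost Γ :=
  integral_nonneg fun _ => by positivity

lemma bddBelow_transportCost (μ ν : Measure E) :
    BddBelow (Set.range fun Γ : {Γ : Measure (E × E) // IsCoupling μ ν Γ} =>
      transportCost (Γ : Measure (E × E))) :=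
  ⟨0, by rintro _ ⟨Γ, rfl⟩; exact transportCost_nonneg _⟩

lemma W2_sq_le_transportCost {μ ν : Measure E} {Γ : Measure (E × E)} (h : IsCoupling μ ν Γ) :
    W2 μ ν ^ 2 ≤ transportCost Γ := by
  have h0 : 0 ≤ ⨅ Γ : {Γ : Measure (E × E) // IsCoupling μ ν Γ},
      transportCost (Γ : Measure (E × E)) := Real.iInf_nonneg fun _ => transportCost_nonneg _
  exact (Real.sq_sqrt h0).trans_le (ciInf_le (bddBelow_transportCost μ ν) ⟨Γ, h⟩)

lemma exists_isCoupling_transportCost_lt (μ ν : Measure E) [IsProbabilityMeasure μ]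
    [IsProbabilityMeasure ν] {δ : ℝ} (hδ : 0 < δ) :
    ∃ Γ, IsCoupling μ ν Γ ∧ transportCost Γ < W2 μ ν ^ 2 + δ := by
  have : Nonempty {Γ : Measure (E × E) // IsCoupling μ ν Γ} :=
    ⟨⟨_, isCoupling_prod μ ν⟩⟩
  have h0 : 0 ≤ ⨅ Γ : {Γ : Measure (E × E) // IsCoupling μ ν Γ},
      transportCost (Γ : Measure (E × E)) := Real.iInf_nonneg fun _ => transportCost_nonneg _
  have hlt : (⨅ Γ : {Γ : Measure (E × E) // IsCoupling μ ν Γ},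
      transportCost (Γ : Measure (E × E))) < W2 μ ν ^ 2 + δ :=
    (Real.sq_sqrt h0).symm.trans_lt (lt_add_of_pos_right _ hδ)
  obtain ⟨Γ, hΓ⟩ := exists_lt_of_ciInf_lt hlt
  exact ⟨Γ, Γ.2, hΓ⟩

lemma W2_le_of_forall_isCoupling {F : Type*} [NormedAddCommGroup F] [MeasurableSpace F]
    {μ ν : Measure E} {μ' ν' : Measure F} [IsProbabilityMeasure μ] [IsProbabilityMeasure ν]
    (h : ∀ Γ, IsCoupling μ ν Γ → ∃ Γ', IsCoupling μ' ν' Γ' ∧ transportCost Γ' ≤ transportCost Γ) :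
    W2 μ' ν' ≤ W2 μ ν := by
  refine abs_le_of_sq_le_sq' (le_of_forall_pos_le_add fun δ hδ => ?_) (Real.sqrt_nonneg _) |>.2
  obtain ⟨Γ, hΓ, hlt⟩ := exists_isCoupling_transportCost_lt μ ν hδ
  obtain ⟨Γ', hΓ', hle⟩ := h Γ hΓ
  exact (W2_sq_le_transportCost hΓ').trans (hle.trans hlt.le)

/-- Adjoining a common independent component does not increase the Wasserstein distance. -/
lemma W2_prod_right_le [BorelSpace E] [SecondCountableTopology E]
    (μ ν γ : Measure E) [IsProbabilityMeasure μ] [IsProbabilityMeasure ν]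
    [IsProbabilityMeasure γ] : W2 (μ.prod γ) (ν.prod γ) ≤ W2 μ ν := by
  refine W2_le_of_forall_isCoupling fun Γ hΓ => ?_
  have := hΓ.isProbabilityMeasure
  let T : (E × E) × E → (E × E) × (E × E) := fun q => ((q.1.1, q.2), (q.1.2, q.2))
  have hT : Measurable T := by fun_prop
  refine ⟨(Γ.prod γ).map T, ⟨?_, ?_⟩, ?_⟩
  · rw [Measure.map_map measurable_fst hT]
    calc _ = (Γ.prod γ).map (Prod.map Prod.fst id) := rfl
      _ = _ := by
        rw [← Measure.map_prod_map _ _ measurable_fst measurable_id, hΓ.1, Measure.map_id]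
  · rw [Measure.map_map measurable_snd hT]
    calc _ = (Γ.prod γ).map (Prod.map Prod.snd id) := rfl
      _ = _ := by
        rw [← Measure.map_prod_map _ _ measurable_snd measurable_id, hΓ.2, Measure.map_id]
  · refine le_of_eq ?_
    unfold transportCost
    rw [integral_map hT.aemeasurable
      (by exact (Continuous.aestronglyMeasurable (by fun_prop)))]
    simp only [T, Prod.mk_sub_mk, sub_self, Prod.norm_mk, norm_zero, norm_nonneg, sup_of_le_left]
    rw [integral_fun_fst (f := fun p : E × E => ‖p.1 - p.2‖ ^ 2)]
    simp

end Coupling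

section Barker

variable {E : Type*} [NormedAddCommGroup E]

/-- Barker's acceptance probability for the move `x ↦ x + z` and the target `exp (-f)`. -/
noncomputable def acceptProb (f : E → ℝ) (z x : E) : ℝ := Real.sigmoid (f x - f (x + z))

/-- The move from `q.1` to `q.1 + z`, accepted when `q.2 ≤ acceptProb f z q.1`. -/
noncomputable def barkerMove (f : E → ℝ) (z : E) (q : E × ℝ) : E :=
  q.1 + if q.2 ≤ acceptProb f z q.1 then z else 0

lemma acceptProb_nonneg (f : E → ℝ) (z x : E) : 0 ≤ acceptProb f z x := Real.sigmoid_nonneg _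

lemma acceptProb_le_one (f : E → ℝ) (z x : E) : acceptProb f z x ≤ 1 := Real.sigmoid_le_one _

lemma exp_neg_mul_acceptProb_neg (f : E → ℝ) (z x : E) :
    Real.exp (-f (x + z)) * acceptProb f (-z) (x + z) = Real.exp (-f x) * acceptProb f z x := by
  have h := Real.sigmoid_mul_rexp_neg (f x - f (x + z))
  have : -f x = -f (x + z) + -(f x - f (x + z)) := by ring
  rw [acceptProb, acceptProb, add_neg_cancel_right, this, Real.exp_add]
  rw [neg_sub] at h ⊢
  rw [← h]
  ring

lemma lintegral_Ioc_ite (a : ℝ) (h0 : 0 ≤ a) (h1 : a ≤ 1) (A B : ℝ≥0∞) :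
    ∫⁻ t in Set.Ioc (0 : ℝ) 1, (if t ≤ a then A else B) =
      ENNReal.ofReal a * A + ENNReal.ofReal (1 - a) * B := by
  rw [← Set.Ioc_union_Ioc_eq_Ioc h0 h1,
    lintegral_union measurableSet_Ioc (Set.Ioc_disjoint_Ioc_of_le le_rfl),
    setLIntegral_congr_fun (g := fun _ => A) measurableSet_Ioc (fun t ht => if_pos ht.2),
    setLIntegral_congr_fun (g := fun _ => B) measurableSet_Ioc (fun t ht => if_neg ht.1.not_ge)]
  simp [mul_comm]

lemma integrableOn_Ioc_ite (a A B r s : ℝ) :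
    IntegrableOn (fun t : ℝ => if t ≤ a then A else B) (Set.Ioc r s) := by
  refine (integrable_const (|A| + |B|)).mono' (Measurable.aestronglyMeasurable
    (Measurable.ite measurableSet_Iic measurable_const measurable_const)) (ae_of_all _ fun t => ?_)
  rw [Real.norm_eq_abs]
  split_ifs <;> simp

lemma integral_Ioc_ite (a : ℝ) (h0 : 0 ≤ a) (h1 : a ≤ 1) (A B : ℝ) :
    ∫ t in Set.Ioc (0 : ℝ) 1, (if t ≤ a then A else B) = a * A + (1 - a) * B := by
  rw [← Set.Ioc_union_Ioc_eq_Ioc h0 h1,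
    setIntegral_union (Set.Ioc_disjoint_Ioc_of_le le_rfl) measurableSet_Ioc
      (integrableOn_Ioc_ite _ _ _ _ _)
      (integrableOn_Ioc_ite _ _ _ _ _),
    setIntegral_congr_fun (g := fun _ => A) measurableSet_Ioc (fun t ht => if_pos ht.2),
    setIntegral_congr_fun (g := fun _ => B) measurableSet_Ioc (fun t ht => if_neg ht.1.not_ge)]
  simp [h0, h1]

variable [MeasurableSpace E] [BorelSpace E]

lemma measurable_acceptProb {f : E → ℝ} (hf : Measurable f) (z : E) :
    Measurable (acceptProb f z) :=
  continuous_sigmoid.measurable.comp (hf.sub (hf.comp (measurable_add_const z)))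

lemma measurable_barkerMove [SecondCountableTopology E] {f : E → ℝ} (hf : Measurable f) (z : E) :
    Measurable (barkerMove f z) :=
  measurable_fst.add (Measurable.ite
    (measurableSet_le measurable_snd ((measurable_acceptProb hf z).comp measurable_fst))
    measurable_const measurable_const)

end Barker

section SynchronousMove

variable {E : Type*} [NormedAddCommGroup E]

/-- The synchronous coupling of two Barker moves. -/
noncomputable def barkerMove₂ (f g : E → ℝ) (z : E) (q : (E × E) × ℝ) : E × E :=
  (barkerMove f z (q.1.1, q.2), barkerMove g z (q.1.2, q.2))

variable [InnerProductSpace ℝ E]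

/-- The mean change of the squared distance under the synchronous move `barkerMove₂ f g z`. -/
noncomputable def costIncrement (f g : E → ℝ) (z : E) (p : E × E) : ℝ :=
  2 * (acceptProb f z p.1 - acceptProb g z p.2) * inner ℝ (p.1 - p.2) z +
    |acceptProb f z p.1 - acceptProb g z p.2| * ‖z‖ ^ 2

lemma integral_sq_barkerMove₂ (f g : E → ℝ) (z : E) (p : E × E) :
    ∫ t in Set.Ioc (0 : ℝ) 1, ‖(barkerMove₂ f g z (p, t)).1 - (barkerMove₂ f g z (p, t)).2‖ ^ 2 =
      ‖p.1 - p.2‖ ^ 2 + costIncrement f g z p := by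
  set a := acceptProb f z p.1 with ha
  set b := acceptProb g z p.2 with hb
  have hexp : ∀ w : E,
      ‖p.1 - p.2 + w‖ ^ 2 = ‖p.1 - p.2‖ ^ 2 + 2 * inner ℝ (p.1 - p.2) w + ‖w‖ ^ 2 :=
    fun w => norm_add_sq_real _ _
  have hpt : ∀ t : ℝ, ‖(barkerMove₂ f g z (p, t)).1 - (barkerMove₂ f g z (p, t)).2‖ ^ 2 =
      (if t ≤ a then ‖p.1 - p.2‖ ^ 2 + 2 * inner ℝ (p.1 - p.2) z else ‖p.1 - p.2‖ ^ 2) +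
      (if t ≤ b then - (2 * inner ℝ (p.1 - p.2) z) else 0) +
      ((if t ≤ max a b then ‖z‖ ^ 2 else 0) + if t ≤ min a b then - ‖z‖ ^ 2 else 0) := by
    intro t
    have h1 : (barkerMove₂ f g z (p, t)).1 - (barkerMove₂ f g z (p, t)).2 =
        p.1 - p.2 + ((if t ≤ a then z else 0) - if t ≤ b then z else 0) := by
      simp only [barkerMove₂, barkerMove, ← ha, ← hb]
      abel
    rw [h1, hexp]
    simp only [le_max_iff, le_min_iff]
    by_cases h2 : t ≤ a <;> by_cases h3 : t ≤ b <;> simp [h2, h3, inner_neg_right]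
  have hadd : ∀ (r C D r' C' D' : ℝ), IntegrableOn
      (fun t : ℝ => (if t ≤ r then C else D) + if t ≤ r' then C' else D') (Set.Ioc 0 1) :=
    fun r C D r' C' D' => (integrableOn_Ioc_ite _ _ _ _ _).add (integrableOn_Ioc_ite _ _ _ _ _)
  have ha0 : 0 ≤ a := acceptProb_nonneg _ _ _
  have hb0 : 0 ≤ b := acceptProb_nonneg _ _ _
  have ha1 : a ≤ 1 := acceptProb_le_one _ _ _
  have hb1 : b ≤ 1 := acceptProb_le_one _ _ _
  simp_rw [hpt]
  rw [integral_add (hadd _ _ _ _ _ _) (hadd _ _ _ _ _ _),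
    integral_add (integrableOn_Ioc_ite _ _ _ _ _) (integrableOn_Ioc_ite _ _ _ _ _),
    integral_add (integrableOn_Ioc_ite _ _ _ _ _) (integrableOn_Ioc_ite _ _ _ _ _),
    integral_Ioc_ite _ ha0 ha1, integral_Ioc_ite _ hb0 hb1,
    integral_Ioc_ite _ (le_max_of_le_left ha0) (max_le ha1 hb1),
    integral_Ioc_ite _ (le_min ha0 hb0) (min_le_of_left_le ha1), costIncrement, ← ha, ← hb,
    ← max_sub_min_eq_abs']
  ring

end SynchronousMove

section Reversibility

variable {E : Type*} [NormedAddCommGroup E] [InnerProductSpace ℝ E] [FiniteDimensional ℝ E]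
  [MeasurableSpace E] [BorelSpace E]

/-- The measure with Lebesgue density `c * exp (-f)`. -/
noncomputable def gibbs (c : ℝ) (f : E → ℝ) : Measure E :=
  volume.withDensity fun x => ENNReal.ofReal (c * Real.exp (-f x))

lemma lintegral_gibbs {c : ℝ} {f : E → ℝ} (hf : Measurable f) {φ : E → ℝ≥0∞}
    (hφ : Measurable φ) :
    ∫⁻ x, φ x ∂gibbs c f = ∫⁻ x, ENNReal.ofReal (c * Real.exp (-f x)) * φ x := by
  rw [gibbs, lintegral_withDensity_eq_lintegral_mul _ (by fun_prop) hφ]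
  rfl

lemma lintegral_acceptProb_mul {c : ℝ} (hc : 0 ≤ c) {f : E → ℝ} (hf : Measurable f) (z : E)
    {φ : E → ℝ≥0∞} (hφ : Measurable φ) :
    ∫⁻ x, ENNReal.ofReal (acceptProb f z x) * φ (x + z) ∂gibbs c f =
      ∫⁻ x, ENNReal.ofReal (acceptProb f (-z) x) * φ x ∂gibbs c f := by
  have h1 := measurable_acceptProb hf z
  have h2 := measurable_acceptProb hf (-z)
  rw [lintegral_gibbs hf (by fun_prop), lintegral_gibbs hf (by fun_prop),
    ← lintegral_add_right_eq_self (fun x => _ * (ENNReal.ofReal (acceptProb f (-z) x) * φ x)) z]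
  refine lintegral_congr fun x => ?_
  rw [← mul_assoc, ← mul_assoc, ← ENNReal.ofReal_mul (by positivity),
    ← ENNReal.ofReal_mul (by positivity), mul_assoc, mul_assoc, exp_neg_mul_acceptProb_neg]

lemma lintegral_barkerMove {μ : Measure E} [IsProbabilityMeasure μ] {f : E → ℝ}
    (hf : Measurable f) (z : E) {φ : E → ℝ≥0∞} (hφ : Measurable φ) :
    ∫⁻ x, φ x ∂((μ.prod (volume.restrict (Set.Ioc (0 : ℝ) 1))).map (barkerMove f z)) =
      (∫⁻ x, ENNReal.ofReal (acceptProb f z x) * φ (x + z) ∂μ) +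
        ∫⁻ x, ENNReal.ofReal (1 - acceptProb f z x) * φ x ∂μ := by
  have h1 := measurable_acceptProb hf z
  have h2 := measurable_barkerMove hf z
  rw [lintegral_map hφ h2, lintegral_prod _ (by fun_prop), ← lintegral_add_left (by fun_prop)]
  refine lintegral_congr fun x => ?_
  rw [← lintegral_Ioc_ite _ (acceptProb_nonneg f z x) (acceptProb_le_one f z x)]
  refine lintegral_congr fun t => ?_
  simp only [barkerMove]
  split_ifs <;> simp

/-- Barker's kernel with the symmetric proposals `z` and `-z` leaves `gibbs c f` invariant. -/
lemma barkerMove_invariant {c : ℝ} (hc : 0 ≤ c) {f : E → ℝ} (hf : Measurable f)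
    [IsProbabilityMeasure (gibbs c f)] (z : E) :
    (2⁻¹ : ℝ≥0∞) • (((gibbs c f).prod (volume.restrict (Set.Ioc (0 : ℝ) 1))).map (barkerMove f z) +
      ((gibbs c f).prod (volume.restrict (Set.Ioc (0 : ℝ) 1))).map (barkerMove f (-z))) =
      gibbs c f := by
  have key : ∀ w : E, ∀ φ : E → ℝ≥0∞, Measurable φ →
      (∫⁻ x, ENNReal.ofReal (acceptProb f w x) * φ x ∂gibbs c f) +
        ∫⁻ x, ENNReal.ofReal (1 - acceptProb f w x) * φ x ∂gibbs c f =
      ∫⁻ x, φ x ∂gibbs c f := by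
    intro w φ hφ
    have h1 := measurable_acceptProb hf w
    rw [← lintegral_add_left (by fun_prop)]
    refine lintegral_congr fun x => ?_
    rw [← add_mul, ← ENNReal.ofReal_add (acceptProb_nonneg f w x)
      (sub_nonneg.2 (acceptProb_le_one f w x))]
    simp
  ext s hs
  have hφ : Measurable (s.indicator (1 : E → ℝ≥0∞)) := measurable_one.indicator hs
  rw [← lintegral_indicator_one hs, ← lintegral_indicator_one hs, lintegral_smul_measure,
    lintegral_add_measure, lintegral_barkerMove hf z hφ, lintegral_barkerMove hf (-z) hφ,
    lintegral_acceptProb_mul hc hf z hφ, lintegral_acceptProb_mul hc hf (-z) hφ, neg_neg,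
    add_add_add_comm, add_comm (∫⁻ x, ENNReal.ofReal (1 - acceptProb f z x) * _ ∂_),
    add_add_add_comm, key z _ hφ, key (-z) _ hφ, ← two_mul, smul_eq_mul, ← mul_assoc,
    ENNReal.inv_mul_cancel (by simp) (by simp), one_mul]

lemma measurable_barkerMove₂ {f g : E → ℝ} (hf : Measurable f) (hg : Measurable g) (z : E) :
    Measurable (barkerMove₂ f g z) := by
  have h1 := measurable_barkerMove hf z
  have h2 := measurable_barkerMove hg z
  unfold barkerMove₂
  fun_prop

lemma map_fst_barkerMove₂ {f g : E → ℝ} (hf : Measurable f) (hg : Measurable g) (z : E)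
    (Γ : Measure (E × E)) [IsProbabilityMeasure Γ] (ρ : Measure ℝ) [SFinite ρ] :
    ((Γ.prod ρ).map (barkerMove₂ f g z)).map Prod.fst =
      ((Γ.map Prod.fst).prod ρ).map (barkerMove f z) := by
  have h : (Γ.map Prod.fst).prod ρ = (Γ.prod ρ).map (Prod.map Prod.fst id) := by
    rw [← Measure.map_prod_map _ _ measurable_fst measurable_id, Measure.map_id]
  rw [h, Measure.map_map measurable_fst (measurable_barkerMove₂ hf hg z),
    Measure.map_map (measurable_barkerMove hf z) (by fun_prop)]
  rfl

lemma map_snd_barkerMove₂ {f g : E → ℝ} (hf : Measurable f) (hg : Measurable g) (z : E)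
    (Γ : Measure (E × E)) [IsProbabilityMeasure Γ] (ρ : Measure ℝ) [SFinite ρ] :
    ((Γ.prod ρ).map (barkerMove₂ f g z)).map Prod.snd =
      ((Γ.map Prod.snd).prod ρ).map (barkerMove g z) := by
  have h : (Γ.map Prod.snd).prod ρ = (Γ.prod ρ).map (Prod.map Prod.snd id) := by
    rw [← Measure.map_prod_map _ _ measurable_snd measurable_id, Measure.map_id]
  rw [h, Measure.map_map measurable_snd (measurable_barkerMove₂ hf hg z),
    Measure.map_map (measurable_barkerMove hg z) (by fun_prop)]
  rfl

lemma IsCoupling.integrable_sq {μ ν : Measure E} {Γ : Measure (E × E)} (h : IsCoupling μ ν Γ)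
    (hμ : Integrable (fun x => ‖x‖ ^ 2) μ) (hν : Integrable (fun x => ‖x‖ ^ 2) ν) :
    Integrable (fun p : E × E => ‖p.1 - p.2‖ ^ 2) Γ := by
  refine (((h.integrable_fst hμ).add (h.integrable_snd hν)).const_mul 2).mono'
    (Continuous.aestronglyMeasurable (by fun_prop)) (ae_of_all _ fun p => ?_)
  rw [Real.norm_of_nonneg (by positivity)]
  have := norm_sub_le p.1 p.2
  simp only [Pi.add_apply]
  nlinarith [sq_nonneg (‖p.1‖ - ‖p.2‖), norm_nonneg (p.1 - p.2)]

/-- One step of the synchronously coupled Barker kernels. -/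
lemma W2_sq_le_integral_costIncrement {c c' : ℝ} (hc : 0 ≤ c) (hc' : 0 ≤ c') {f g : E → ℝ}
    (hf : Measurable f) (hg : Measurable g) [IsProbabilityMeasure (gibbs c f)]
    [IsProbabilityMeasure (gibbs c' g)]
    (hμ : Integrable (fun x => ‖x‖ ^ 2) (gibbs c f))
    (hν : Integrable (fun x => ‖x‖ ^ 2) (gibbs c' g))
    {Γ : Measure (E × E)} (hΓ : IsCoupling (gibbs c f) (gibbs c' g) Γ) (z : E) :
    Integrable (fun p : E × E => ‖p.1 - p.2‖ ^ 2 +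
        2⁻¹ * (costIncrement f g z p + costIncrement f g (-z) p)) Γ ∧
      W2 (gibbs c f) (gibbs c' g) ^ 2 ≤ ∫ p, (‖p.1 - p.2‖ ^ 2 +
        2⁻¹ * (costIncrement f g z p + costIncrement f g (-z) p)) ∂Γ := by
  have := hΓ.isProbabilityMeasure
  let ρ : Measure ℝ := volume.restrict (Set.Ioc (0 : ℝ) 1)
  have : IsProbabilityMeasure ρ := ⟨by simp [ρ]⟩
  have hm := measurable_barkerMove₂ hf hg
  have hΓ' : IsCoupling (gibbs c f) (gibbs c' g) ((2⁻¹ : ℝ≥0∞) •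
      ((Γ.prod ρ).map (barkerMove₂ f g z) + (Γ.prod ρ).map (barkerMove₂ f g (-z)))) := by
    constructor
    · rw [Measure.map_smul, Measure.map_add _ _ measurable_fst, map_fst_barkerMove₂ hf hg,
        map_fst_barkerMove₂ hf hg, hΓ.1, barkerMove_invariant hc hf]
    · rw [Measure.map_smul, Measure.map_add _ _ measurable_snd, map_snd_barkerMove₂ hf hg,
        map_snd_barkerMove₂ hf hg, hΓ.2, barkerMove_invariant hc' hg]
  have hsq := hΓ.integrable_sq hμ hν
  have hmsq : Measurable fun p : E × E => ‖p.1 - p.2‖ ^ 2 := by fun_prop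
  have hint : ∀ w : E, Integrable (fun q : (E × E) × ℝ =>
      ‖(barkerMove₂ f g w q).1 - (barkerMove₂ f g w q).2‖ ^ 2) (Γ.prod ρ) := by
    intro w
    refine ((hsq.comp_fst ρ).const_mul 2 |>.add (integrable_const (2 * ‖w‖ ^ 2))).mono'
      (hmsq.comp (hm w)).aestronglyMeasurable (ae_of_all _ fun q => ?_)
    rw [Real.norm_of_nonneg (by positivity)]
    have h1 : (barkerMove₂ f g w q).1 - (barkerMove₂ f g w q).2 = q.1.1 - q.1.2 +
        ((if q.2 ≤ acceptProb f w q.1.1 then w else 0) -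
          if q.2 ≤ acceptProb g w q.1.2 then w else 0) := by
      simp only [barkerMove₂, barkerMove]
      abel
    have h2 : ‖(if q.2 ≤ acceptProb f w q.1.1 then w else 0) -
          if q.2 ≤ acceptProb g w q.1.2 then w else 0‖ ≤ ‖w‖ := by
      split_ifs <;> simp
    have h3 := (norm_add_le (q.1.1 - q.1.2) ((if q.2 ≤ acceptProb f w q.1.1 then w else 0) -
          if q.2 ≤ acceptProb g w q.1.2 then w else 0)).trans (add_le_add_right h2 _)
    rw [h1]
    simp only [Pi.add_apply]
    have := pow_le_pow_left₀ (norm_nonneg _) h3 2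
    nlinarith [sq_nonneg (‖q.1.1 - q.1.2‖ - ‖w‖)]
  have hint' : ∀ w : E, Integrable (fun p : E × E => ‖p.1 - p.2‖ ^ 2)
      ((Γ.prod ρ).map (barkerMove₂ f g w)) := fun w =>
    (integrable_map_measure hmsq.aestronglyMeasurable (hm w).aemeasurable).2 (hint w)
  have hval : ∀ w : E, ∫ p : E × E, ‖p.1 - p.2‖ ^ 2 ∂((Γ.prod ρ).map (barkerMove₂ f g w)) =
      ∫ p, (‖p.1 - p.2‖ ^ 2 + costIncrement f g w p) ∂Γ := by
    intro w
    rw [integral_map (hm w).aemeasurable hmsq.aestronglyMeasurable, integral_prod _ (hint w)]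
    exact integral_congr_ae (ae_of_all _ fun p => integral_sq_barkerMove₂ f g w p)
  have hint'' : ∀ w : E, Integrable (fun p : E × E => ‖p.1 - p.2‖ ^ 2 + costIncrement f g w p) Γ :=
    fun w => (hint w).integral_prod_left.congr
      (ae_of_all _ fun p => integral_sq_barkerMove₂ f g w p)
  have hcongr : ∀ p : E × E, 2⁻¹ * ((‖p.1 - p.2‖ ^ 2 + costIncrement f g z p) +
      (‖p.1 - p.2‖ ^ 2 + costIncrement f g (-z) p)) =
      ‖p.1 - p.2‖ ^ 2 + 2⁻¹ * (costIncrement f g z p + costIncrement f g (-z) p) :=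
    fun p => by ring
  refine ⟨(((hint'' z).add (hint'' (-z))).const_mul 2⁻¹).congr (ae_of_all _ hcongr),
    (W2_sq_le_transportCost hΓ').trans_eq ?_⟩
  rw [transportCost, integral_smul_measure, integral_add_measure (hint' _) (hint' _), hval, hval,
    ← integral_add (hint'' _) (hint'' _), smul_eq_mul, ← integral_const_mul]
  simp [← hcongr]

end Reversibility

section Drift

variable {E : Type*} [NormedAddCommGroup E] [InnerProductSpace ℝ E] [CompleteSpace E]

/-- `F` is the gradient of `f`, is continuous, and grows at most polynomially. -/
structure HasPolyGradient (f : E → ℝ) (F : E → E) (C : ℝ) (k : ℕ) : Prop where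
  hasGradientAt : ∀ x, HasGradientAt f (F x) x
  continuous_gradient : Continuous F
  norm_le : ∀ x, ‖F x‖ ≤ C * (1 + ‖x‖) ^ k

lemma abs_sigmoid_sub_le (a b : ℝ) : |Real.sigmoid a - Real.sigmoid b| ≤ |a - b| := by
  have h := Convex.norm_image_sub_le_of_norm_hasDerivWithin_le (C := 1) (s := Set.univ) (x := b)
    (y := a) (fun x _ => (Real.hasDerivAt_sigmoid x).hasDerivWithinAt) (fun x _ => ?_)
    convex_univ (Set.mem_univ _) (Set.mem_univ _)
  · simpa using h
  · have h0 := Real.sigmoid_pos x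
    have h1 := Real.sigmoid_lt_one x
    rw [Real.norm_eq_abs, abs_le]
    constructor <;> nlinarith

namespace HasPolyGradient

variable {f : E → ℝ} {F : E → E} {C : ℝ} {k : ℕ}

lemma const_nonneg (h : HasPolyGradient f F C k) : 0 ≤ C := by
  simpa using (norm_nonneg _).trans (h.norm_le 0)

lemma continuous (h : HasPolyGradient f F C k) : Continuous f :=
  continuous_iff_continuousAt.2 fun x => (h.hasGradientAt x).differentiableAt.continuousAt

lemma abs_sub_le (h : HasPolyGradient f F C k) (x z : E) (hz : ‖z‖ ≤ 1) :
    |f x - f (x + z)| ≤ C * 2 ^ k * (1 + ‖x‖) ^ k * ‖z‖ := by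
  have hC := h.const_nonneg
  have hmvt := (convex_closedBall x ‖z‖).norm_image_sub_le_of_norm_hasFDerivWithin_le
    (f := f) (C := C * 2 ^ k * (1 + ‖x‖) ^ k) (x := x + z) (y := x)
    (fun y _ => (h.hasGradientAt y).hasFDerivAt.hasFDerivWithinAt) (fun y hy => ?_)
    (by simp) (by simp)
  · simpa using hmvt
  · rw [LinearIsometryEquiv.norm_map]
    refine (h.norm_le y).trans ?_
    rw [mul_assoc, ← mul_pow]
    have h1 : ‖y‖ ≤ ‖x‖ + 1 := by
      have h2 := norm_le_norm_add_norm_sub' y x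
      rw [mem_closedBall_iff_norm] at hy
      linarith
    gcongr
    linarith [norm_nonneg x]

lemma abs_acceptProb_sub_half_le (h : HasPolyGradient f F C k) (x z : E) (hz : ‖z‖ ≤ 1) :
    |acceptProb f z x - 2⁻¹| ≤ C * 2 ^ k * (1 + ‖x‖) ^ k * ‖z‖ := by
  have h1 := abs_sigmoid_sub_le (f x - f (x + z)) 0
  rw [Real.sigmoid_zero, sub_zero] at h1
  exact h1.trans (h.abs_sub_le x z hz)

end HasPolyGradient

/-- The deviation of the rescaled Barker drift in direction `e` from half the directional
derivative. -/
noncomputable def driftError (f : E → ℝ) (F : E → E) (s : ℝ) (e x : E) : ℝ :=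
  (acceptProb f (s • e) x - acceptProb f (-(s • e)) x) / s + 2⁻¹ * inner ℝ (F x) e

namespace HasPolyGradient

variable {f : E → ℝ} {F : E → E} {C : ℝ} {k : ℕ}

lemma abs_driftError_le (h : HasPolyGradient f F C k) {s : ℝ} (hs : 0 < s) (hs1 : s ≤ 1) {e : E}
    (he : ‖e‖ = 1) (x : E) : |driftError f F s e x| ≤ 3 * (C * 2 ^ k) * (1 + ‖x‖) ^ k := by
  have hC := h.const_nonneg
  have hz : ‖s • e‖ = s := by rw [norm_smul, he, mul_one, Real.norm_of_nonneg hs.le]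
  have h1 := h.abs_acceptProb_sub_half_le x (s • e) (hz.trans_le hs1)
  have h2 := h.abs_acceptProb_sub_half_le x (-(s • e)) ((norm_neg _).trans_le (hz.trans_le hs1))
  rw [norm_neg] at h2
  rw [hz] at h1 h2
  have h3 : |(acceptProb f (s • e) x - acceptProb f (-(s • e)) x) / s| ≤
      2 * (C * 2 ^ k * (1 + ‖x‖) ^ k) := by
    rw [abs_div, abs_of_pos hs, div_le_iff₀ hs]
    have := _root_.abs_sub_le (acceptProb f (s • e) x) 2⁻¹ (acceptProb f (-(s • e)) x)
    rw [abs_sub_comm 2⁻¹] at this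
    linarith
  have h4 : |2⁻¹ * inner ℝ (F x) e| ≤ C * 2 ^ k * (1 + ‖x‖) ^ k := by
    have h5 := abs_real_inner_le_norm (F x) e
    rw [he, mul_one] at h5
    have h6 : C * (1 + ‖x‖) ^ k ≤ C * 2 ^ k * (1 + ‖x‖) ^ k := by
      have : (1 : ℝ) ≤ 2 ^ k := one_le_pow₀ (by norm_num)
      gcongr
      exact le_mul_of_one_le_right hC this
    rw [abs_mul, abs_of_pos (by norm_num : (0 : ℝ) < 2⁻¹)]
    linarith [h.norm_le x, abs_nonneg (inner ℝ (F x) e)]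
  exact (abs_add_le _ _).trans (by linarith)

lemma tendsto_driftError (h : HasPolyGradient f F C k) (e x : E) :
    Tendsto (fun s => driftError f F s e x) (𝓝[>] 0) (𝓝 0) := by
  have hline : ∀ w : E, HasDerivAt (fun s : ℝ => acceptProb f (s • w) x)
      (4⁻¹ * -inner ℝ (F x) w) 0 := by
    intro w
    have h1 : HasDerivAt (fun s : ℝ => x + s • w) w 0 := by
      simpa using ((hasDerivAt_id (0 : ℝ)).smul_const w).const_add x
    have h0 : HasFDerivAt f (InnerProductSpace.toDual ℝ E (F x)) (x + (0 : ℝ) • w) := by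
      simpa using (h.hasGradientAt x).hasFDerivAt
    have h2 : HasDerivAt (fun s : ℝ => f (x + s • w)) (inner ℝ (F x) w) 0 := by
      convert! h0.comp_hasDerivAt 0 h1 using 1
    have h3 := (Real.hasDerivAt_sigmoid (f x - f (x + (0 : ℝ) • w))).comp 0 (h2.const_sub (f x))
    convert! h3 using 1
    simp
    norm_num
  have hdiff : HasDerivAt (fun s : ℝ => acceptProb f (s • e) x - acceptProb f (-(s • e)) x)
      (-(2⁻¹ * inner ℝ (F x) e)) 0 := by
    have h4 := (hline e).sub (hline (-e))
    simp only [smul_neg, inner_neg_right] at h4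
    convert! h4 using 1
    ring
  have h5 := hdiff.hasDerivWithinAt (s := Set.Ioi 0)
  rw [hasDerivWithinAt_iff_tendsto_slope' (by simp)] at h5
  have h6 := h5.add_const (2⁻¹ * inner ℝ (F x) e)
  rw [neg_add_cancel] at h6
  refine h6.congr fun s => ?_
  simp [slope_def_field, driftError]

variable [MeasurableSpace E] [BorelSpace E]

lemma measurable_driftError (h : HasPolyGradient f F C k) (s : ℝ) (e : E) :
    Measurable (driftError f F s e) := by
  have h1 := measurable_acceptProb h.continuous.measurable (s • e)
  have h2 := measurable_acceptProb h.continuous.measurable (-(s • e))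
  have h3 : Measurable fun x => inner ℝ (F x) e :=
    (h.continuous_gradient.inner continuous_const).measurable
  unfold driftError
  fun_prop

lemma integrable_driftError_sq (h : HasPolyGradient f F C k) {μ : Measure E}
    (hμ : ∀ n : ℕ, Integrable (fun x => (1 + ‖x‖) ^ n) μ) {s : ℝ} (hs : 0 < s) (hs1 : s ≤ 1)
    {e : E} (he : ‖e‖ = 1) : Integrable (fun x => driftError f F s e x ^ 2) μ := by
  refine ((hμ (k * 2)).const_mul ((3 * (C * 2 ^ k)) ^ 2)).mono'
    ((h.measurable_driftError s e).pow_const 2).aestronglyMeasurable (ae_of_all _ fun x => ?_)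
  rw [Real.norm_of_nonneg (sq_nonneg _), pow_mul, ← mul_pow]
  exact sq_le_sq' (neg_le_of_abs_le (h.abs_driftError_le hs hs1 he x))
    (le_of_abs_le (h.abs_driftError_le hs hs1 he x))

lemma tendsto_integral_driftError_sq (h : HasPolyGradient f F C k) {μ : Measure E}
    (hμ : ∀ n : ℕ, Integrable (fun x => (1 + ‖x‖) ^ n) μ) {e : E} (he : ‖e‖ = 1) :
    Tendsto (fun s => ∫ x, driftError f F s e x ^ 2 ∂μ) (𝓝[>] 0) (𝓝 0) := by
  have hmem : ∀ᶠ s : ℝ in 𝓝[>] 0, 0 < s ∧ s ≤ 1 := by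
    filter_upwards [Ioc_mem_nhdsGT (zero_lt_one' ℝ)] with s hs using hs
  suffices Tendsto (fun s => ∫ x, driftError f F s e x ^ 2 ∂μ) (𝓝[>] 0) (𝓝 (∫ _, 0 ∂μ)) by
    simpa using this
  refine tendsto_integral_filter_of_dominated_convergence
    (fun x => (3 * (C * 2 ^ k)) ^ 2 * (1 + ‖x‖) ^ (k * 2))
    (Eventually.of_forall fun s =>
      ((h.measurable_driftError s e).pow_const 2).aestronglyMeasurable) ?_
    ((hμ (k * 2)).const_mul _) (ae_of_all _ fun x => ?_)
  · filter_upwards [hmem] with s hs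
    refine ae_of_all _ fun x => ?_
    rw [Real.norm_of_nonneg (sq_nonneg _), pow_mul, ← mul_pow]
    exact sq_le_sq' (neg_le_of_abs_le (h.abs_driftError_le hs.1 hs.2 he x))
      (le_of_abs_le (h.abs_driftError_le hs.1 hs.2 he x))
  · simpa using (h.tendsto_driftError e x).pow 2

end HasPolyGradient

end Drift

section Contraction

variable {E : Type*} [NormedAddCommGroup E] [InnerProductSpace ℝ E] [FiniteDimensional ℝ E]

lemma costIncrement_add_neg_le {f g : E → ℝ} {F G : E → E} {C C' : ℝ} {k k' : ℕ}
    (hF : HasPolyGradient f F C k) (hG : HasPolyGradient g G C' k') {s : ℝ} (hs : 0 < s)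
    (hs1 : s ≤ 1) {e : E} (he : ‖e‖ = 1) (p : E × E) :
    2⁻¹ * (costIncrement f g (s • e) p + costIncrement f g (-(s • e)) p) ≤
      s ^ 2 * (-(2⁻¹ * (inner ℝ (p.1 - p.2) e * inner ℝ e (F p.1 - G p.2))) +
        ‖p.1 - p.2‖ * (|driftError f F s e p.1| + |driftError g G s e p.2|) +
        s * (C * 2 ^ k * (1 + ‖p.1‖) ^ k + C' * 2 ^ k' * (1 + ‖p.2‖) ^ k')) := by
  obtain ⟨x, y⟩ := p
  have hz : ‖s • e‖ = s := by rw [norm_smul, he, mul_one, Real.norm_of_nonneg hs.le]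
  have hz' : ‖-(s • e)‖ = s := by rw [norm_neg, hz]
  have b1 := hF.abs_acceptProb_sub_half_le x (s • e) (hz.trans_le hs1)
  have b2 := hF.abs_acceptProb_sub_half_le x (-(s • e)) (hz'.trans_le hs1)
  have b3 := hG.abs_acceptProb_sub_half_le y (s • e) (hz.trans_le hs1)
  have b4 := hG.abs_acceptProb_sub_half_le y (-(s • e)) (hz'.trans_le hs1)
  rw [hz] at b1 b3
  rw [hz'] at b2 b4
  have key : ∀ a b A B : ℝ, |a - 2⁻¹| ≤ A → |b - 2⁻¹| ≤ B → |a - b| ≤ A + B := by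
    intro a b A B h1 h2
    have := abs_sub_le a 2⁻¹ b
    rw [abs_sub_comm 2⁻¹] at this
    linarith
  have c1 := key _ _ _ _ b1 b3
  have c2 := key _ _ _ _ b2 b4
  have hα : acceptProb f (s • e) x - acceptProb f (-(s • e)) x =
      s * (driftError f F s e x - 2⁻¹ * inner ℝ (F x) e) := by
    unfold driftError; field_simp; ring
  have hβ : acceptProb g (s • e) y - acceptProb g (-(s • e)) y =
      s * (driftError g G s e y - 2⁻¹ * inner ℝ (G y) e) := by
    unfold driftError; field_simp; ring
  have hd : inner ℝ (x - y) e * (driftError f F s e x - driftError g G s e y) ≤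
      ‖x - y‖ * (|driftError f F s e x| + |driftError g G s e y|) := by
    have h1 := abs_real_inner_le_norm (x - y) e
    rw [he, mul_one] at h1
    refine (le_abs_self _).trans ?_
    rw [abs_mul]
    exact mul_le_mul h1 (abs_sub _ _) (abs_nonneg _) (norm_nonneg _)
  have hinner : inner ℝ e (F x - G y) = inner ℝ (F x) e - inner ℝ (G y) e := by
    rw [inner_sub_right, real_inner_comm, real_inner_comm e (G y)]
  calc 2⁻¹ * (costIncrement f g (s • e) (x, y) + costIncrement f g (-(s • e)) (x, y))
      = s * inner ℝ (x - y) e * ((acceptProb f (s • e) x - acceptProb f (-(s • e)) x) -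
          (acceptProb g (s • e) y - acceptProb g (-(s • e)) y)) +
        2⁻¹ * s ^ 2 * (|acceptProb f (s • e) x - acceptProb g (s • e) y| +
          |acceptProb f (-(s • e)) x - acceptProb g (-(s • e)) y|) := by
        simp only [costIncrement, hz, hz', inner_neg_right, inner_smul_right]
        ring
    _ ≤ s * inner ℝ (x - y) e * ((acceptProb f (s • e) x - acceptProb f (-(s • e)) x) -
          (acceptProb g (s • e) y - acceptProb g (-(s • e)) y)) +
        2⁻¹ * s ^ 2 * (2 * s * (C * 2 ^ k * (1 + ‖x‖) ^ k + C' * 2 ^ k' * (1 + ‖y‖) ^ k')) := by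
        gcongr
        linarith
    _ = s ^ 2 * (-(2⁻¹ * (inner ℝ (x - y) e * inner ℝ e (F x - G y))) +
        inner ℝ (x - y) e * (driftError f F s e x - driftError g G s e y) +
        s * (C * 2 ^ k * (1 + ‖x‖) ^ k + C' * 2 ^ k' * (1 + ‖y‖) ^ k')) := by
        rw [hα, hβ, hinner]
        ring
    _ ≤ _ := by gcongr

lemma sum_costIncrement_le {f g : E → ℝ} {F G : E → E} {C C' : ℝ} {k k' : ℕ}
    (hF : HasPolyGradient f F C k) (hG : HasPolyGradient g G C' k') {lam : ℝ} (hlam : 0 < lam)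
    (hmono : ∀ x y, 2 * lam * ‖x - y‖ ^ 2 ≤ inner ℝ (F x - F y) (x - y))
    {ι : Type*} [Fintype ι] (b : OrthonormalBasis ι ℝ E) {s : ℝ} (hs : 0 < s)
    (hs1 : s ≤ 1) (p : E × E) :
    ∑ i, 2⁻¹ * (costIncrement f g (s • b i) p + costIncrement f g (-(s • b i)) p) ≤
      s ^ 2 * (-(lam / 2 * ‖p.1 - p.2‖ ^ 2) + 1 / (4 * lam) * ‖F p.2 - G p.2‖ ^ 2 +
        2 * Fintype.card ι / lam *
          ∑ i, (driftError f F s (b i) p.1 ^ 2 + driftError g G s (b i) p.2 ^ 2) +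
        Fintype.card ι * (s * (C * 2 ^ k * (1 + ‖p.1‖) ^ k + C' * 2 ^ k' * (1 + ‖p.2‖) ^ k'))) := by
  refine (Finset.sum_le_sum fun i _ =>
    costIncrement_add_neg_le hF hG hs hs1 (b.norm_eq_one i) p).trans ?_
  obtain ⟨x, y⟩ := p
  rw [← Finset.mul_sum]
  refine mul_le_mul_of_nonneg_left ?_ (by positivity)
  rw [Finset.sum_add_distrib, Finset.sum_add_distrib, Finset.sum_neg_distrib, ← Finset.mul_sum,
    b.sum_inner_mul_inner, ← Finset.mul_sum, Finset.sum_const, Finset.card_univ, nsmul_eq_mul]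
  refine add_le_add ?_ le_rfl
  set S := ∑ i, (|driftError f F s (b i) x| + |driftError g G s (b i) y|) with hS
  set Q := ∑ i, (driftError f F s (b i) x ^ 2 + driftError g G s (b i) y ^ 2) with hQ
  have hSQ : S ^ 2 ≤ 2 * Fintype.card ι * Q := by
    have h1 := sq_sum_le_card_mul_sum_sq (s := Finset.univ)
      (f := fun i => |driftError f F s (b i) x| + |driftError g G s (b i) y|)
    rw [Finset.card_univ] at h1
    refine h1.trans ?_
    rw [mul_comm (2 : ℝ), mul_assoc, hQ, Finset.mul_sum Finset.univ _ (2 : ℝ)]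
    refine mul_le_mul_of_nonneg_left (Finset.sum_le_sum fun i _ => ?_) (by positivity)
    nlinarith [sq_nonneg (|driftError f F s (b i) x| - |driftError g G s (b i) y|),
      sq_abs (driftError f F s (b i) x), sq_abs (driftError g G s (b i) y)]
  have hsplit : inner ℝ (x - y) (F x - G y) =
      inner ℝ (F x - F y) (x - y) + inner ℝ (x - y) (F y - G y) := by
    rw [real_inner_comm (x - y) (F x - F y), ← inner_add_right, sub_add_sub_cancel]
  have hcs : -(‖x - y‖ * ‖F y - G y‖) ≤ inner ℝ (x - y) (F y - G y) :=
    neg_le_of_abs_le (abs_real_inner_le_norm _ _)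
  have hm := hmono x y
  set D := ‖x - y‖
  set H := ‖F y - G y‖
  have hyoung : D * (2⁻¹ * H + S) ≤ lam / 2 * D ^ 2 + 1 / (2 * lam) * (2⁻¹ * H + S) ^ 2 := by
    have : lam / 2 * D ^ 2 + 1 / (2 * lam) * (2⁻¹ * H + S) ^ 2 - D * (2⁻¹ * H + S) =
        1 / (2 * lam) * (lam * D - (2⁻¹ * H + S)) ^ 2 := by
      field_simp; ring
    have h2 : 0 ≤ 1 / (2 * lam) * (lam * D - (2⁻¹ * H + S)) ^ 2 := by positivity
    linarith
  have hsq : (2⁻¹ * H + S) ^ 2 ≤ 2⁻¹ * H ^ 2 + 4 * Fintype.card ι * Q := by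
    nlinarith [sq_nonneg (2⁻¹ * H - S)]
  have hfin : 1 / (2 * lam) * (2⁻¹ * H + S) ^ 2 ≤
      1 / (4 * lam) * H ^ 2 + 2 * Fintype.card ι / lam * Q := by
    refine (mul_le_mul_of_nonneg_left hsq (by positivity)).trans_eq ?_
    field_simp; ring
  rw [hsplit]
  linarith

variable [MeasurableSpace E] [BorelSpace E]

/-- The Wasserstein distance between a strongly log-concave Gibbs measure and another Gibbs
measure is controlled by the `L²` distance of the gradients of their potentials. -/
theorem W2_gibbs_sq_le {f g : E → ℝ} {F G : E → E} {C C' : ℝ} {k k' : ℕ}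
    (hF : HasPolyGradient f F C k) (hG : HasPolyGradient g G C' k') {lam : ℝ} (hlam : 0 < lam)
    (hmono : ∀ x y, 2 * lam * ‖x - y‖ ^ 2 ≤ inner ℝ (F x - F y) (x - y))
    {c c' : ℝ} (hc : 0 ≤ c) (hc' : 0 ≤ c') [IsProbabilityMeasure (gibbs c f)]
    [IsProbabilityMeasure (gibbs c' g)]
    (hμ : ∀ n : ℕ, Integrable (fun x => (1 + ‖x‖) ^ n) (gibbs c f))
    (hν : ∀ n : ℕ, Integrable (fun x => (1 + ‖x‖) ^ n) (gibbs c' g))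
    (hH : Integrable (fun x => ‖F x - G x‖ ^ 2) (gibbs c' g)) :
    W2 (gibbs c f) (gibbs c' g) ^ 2 ≤
      1 / (2 * lam ^ 2) * ∫ x, ‖F x - G x‖ ^ 2 ∂gibbs c' g := by
  set μ := gibbs c f with hμdef
  set ν := gibbs c' g with hνdef
  let b := stdOrthonormalBasis ℝ E
  set N := (Fintype.card (Fin (Module.finrank ℝ E)) : ℝ) with hN
  set h2 := ∫ x, ‖F x - G x‖ ^ 2 ∂ν with hh2
  set M := (∫ x, C * 2 ^ k * (1 + ‖x‖) ^ k ∂μ) + ∫ x, C' * 2 ^ k' * (1 + ‖x‖) ^ k' ∂ν with hM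
  let err : ℝ → ℝ := fun s => ∑ i, ((∫ x, driftError f F s (b i) x ^ 2 ∂μ) +
    ∫ x, driftError g G s (b i) x ^ 2 ∂ν)
  have hμ2 : Integrable (fun x => ‖x‖ ^ 2) μ := (hμ 2).mono'
    (Continuous.aestronglyMeasurable (by fun_prop)) (ae_of_all _ fun x => by
      rw [Real.norm_of_nonneg (by positivity)]; gcongr; linarith)
  have hν2 : Integrable (fun x => ‖x‖ ^ 2) ν := (hν 2).mono'
    (Continuous.aestronglyMeasurable (by fun_prop)) (ae_of_all _ fun x => by
      rw [Real.norm_of_nonneg (by positivity)]; gcongr; linarith)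
  have hstep : ∀ s : ℝ, 0 < s → s ≤ 1 → lam / 2 * W2 μ ν ^ 2 ≤
      1 / (4 * lam) * h2 + 2 * N / lam * err s + N * (s * M) + N * s := by
    intro s hs hs1
    obtain ⟨Γ, hΓ, hlt⟩ := exists_isCoupling_transportCost_lt μ ν (pow_pos hs 3)
    have := hΓ.isProbabilityMeasure
    have hone := fun i => W2_sq_le_integral_costIncrement hc hc' hF.continuous.measurable
      hG.continuous.measurable hμ2 hν2 hΓ (s • b i)
    have hsq := hΓ.integrable_sq hμ2 hν2
    have i2 := hΓ.integrable_snd hH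
    have i3 : ∀ i, Integrable (fun p : E × E => driftError f F s (b i) p.1 ^ 2 +
        driftError g G s (b i) p.2 ^ 2) Γ := fun i =>
      (hΓ.integrable_fst (hF.integrable_driftError_sq hμ hs hs1 (b.norm_eq_one i))).add
        (hΓ.integrable_snd (hG.integrable_driftError_sq hν hs hs1 (b.norm_eq_one i)))
    have i3' := integrable_finsetSum Finset.univ fun i _ => i3 i
    have i4 : Integrable (fun p : E × E => C * 2 ^ k * (1 + ‖p.1‖) ^ k +
        C' * 2 ^ k' * (1 + ‖p.2‖) ^ k') Γ :=
      (hΓ.integrable_fst ((hμ k).const_mul _)).add (hΓ.integrable_snd ((hν k').const_mul _))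
    have e3 : ∫ p, ∑ i, (driftError f F s (b i) p.1 ^ 2 + driftError g G s (b i) p.2 ^ 2) ∂Γ =
        err s := by
      rw [integral_finsetSum _ fun i _ => i3 i]
      refine Finset.sum_congr rfl fun i _ => ?_
      have j1 := hF.integrable_driftError_sq hμ hs hs1 (b.norm_eq_one i)
      have j2 := hG.integrable_driftError_sq hν hs hs1 (b.norm_eq_one i)
      rw [integral_add (hΓ.integrable_fst j1) (hΓ.integrable_snd j2), hΓ.integral_fst j1,
        hΓ.integral_snd j2]
    have e4 : ∫ p : E × E, (C * 2 ^ k * (1 + ‖p.1‖) ^ k + C' * 2 ^ k' * (1 + ‖p.2‖) ^ k') ∂Γ =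
        M := by
      have j1 := (hμ k).const_mul (C * 2 ^ k)
      have j2 := (hν k').const_mul (C' * 2 ^ k')
      rw [integral_add (hΓ.integrable_fst j1) (hΓ.integrable_snd j2), hΓ.integral_fst j1,
        hΓ.integral_snd j2]
    let U : E × E → ℝ := fun p => N * ‖p.1 - p.2‖ ^ 2 +
      s ^ 2 * (-(lam / 2 * ‖p.1 - p.2‖ ^ 2) + 1 / (4 * lam) * ‖F p.2 - G p.2‖ ^ 2 +
        2 * N / lam * ∑ i, (driftError f F s (b i) p.1 ^ 2 + driftError g G s (b i) p.2 ^ 2) +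
        N * (s * (C * 2 ^ k * (1 + ‖p.1‖) ^ k + C' * 2 ^ k' * (1 + ‖p.2‖) ^ k')))
    have k1 := hsq.const_mul N
    have k2 := (hsq.const_mul (lam / 2)).neg
    have k3 := i2.const_mul (1 / (4 * lam))
    have k4 := i3'.const_mul (2 * N / lam)
    have k5 := (i4.const_mul s).const_mul N
    have hUint : Integrable U Γ :=
      k1.add ((((k2.add k3).add k4).add k5).const_mul (s ^ 2))
    have hUval : ∫ p, U p ∂Γ = N * transportCost Γ + s ^ 2 * (-(lam / 2 * transportCost Γ) +
        1 / (4 * lam) * h2 + 2 * N / lam * err s + N * (s * M)) := by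
      have l1 := integral_add k1 ((((k2.add k3).add k4).add k5).const_mul (s ^ 2))
      have l2 := integral_add ((k2.add k3).add k4) k5
      have l3 := integral_add (k2.add k3) k4
      have l4 := integral_add k2 k3
      simp only [Pi.add_apply, Pi.neg_apply, integral_const_mul, integral_neg, e3, e4]
        at l1 l2 l3 l4
      rw [hΓ.integral_snd hH] at l4
      simp only [U]
      rw [l1, l2, l3, l4]
      rfl
    have hsum : N * W2 μ ν ^ 2 ≤ ∫ p, U p ∂Γ := by
      calc N * W2 μ ν ^ 2 = ∑ _i : Fin (Module.finrank ℝ E), W2 μ ν ^ 2 := by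
            rw [Finset.sum_const, Finset.card_univ, nsmul_eq_mul]
        _ ≤ ∑ i, ∫ p, (‖p.1 - p.2‖ ^ 2 + 2⁻¹ * (costIncrement f g (s • b i) p +
              costIncrement f g (-(s • b i)) p)) ∂Γ := Finset.sum_le_sum fun i _ => (hone i).2
        _ = ∫ p, ∑ i, (‖p.1 - p.2‖ ^ 2 + 2⁻¹ * (costIncrement f g (s • b i) p +
              costIncrement f g (-(s • b i)) p)) ∂Γ :=
            (integral_finsetSum _ fun i _ => (hone i).1).symm
        _ ≤ ∫ p, U p ∂Γ := by
            refine integral_mono (integrable_finsetSum _ fun i _ => (hone i).1) hUint fun p => ?_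
            simp only
            rw [Finset.sum_add_distrib, Finset.sum_const, Finset.card_univ, nsmul_eq_mul]
            exact add_le_add le_rfl (sum_costIncrement_le hF hG hlam hmono b hs hs1 p)
    have hle := W2_sq_le_transportCost hΓ
    have hN0 : 0 ≤ N := by positivity
    rw [hUval] at hsum
    have h3 : s ^ 2 * (lam / 2 * transportCost Γ) ≤ s ^ 2 *
        (1 / (4 * lam) * h2 + 2 * N / lam * err s + N * (s * M) + N * s) := by
      nlinarith [mul_le_mul_of_nonneg_left hlt.le hN0]
    refine (mul_le_mul_of_nonneg_left hle (by positivity)).trans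
      (le_of_mul_le_mul_left h3 (by positivity))
  have herr : Tendsto err (𝓝[>] 0) (𝓝 0) := by
    have := tendsto_finsetSum Finset.univ fun i _ =>
      (hF.tendsto_integral_driftError_sq hμ (b.norm_eq_one i)).add
        (hG.tendsto_integral_driftError_sq hν (b.norm_eq_one i))
    simpa [err] using this
  have hs0 : Tendsto (fun s : ℝ => s) (𝓝[>] 0) (𝓝 0) := tendsto_id.mono_left nhdsWithin_le_nhds
  have hlim : Tendsto (fun s => 1 / (4 * lam) * h2 + 2 * N / lam * err s + N * (s * M) + N * s)
      (𝓝[>] 0) (𝓝 (1 / (4 * lam) * h2)) := by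
    have := (((herr.const_mul (2 * N / lam)).const_add (1 / (4 * lam) * h2)).add
      ((hs0.mul_const M).const_mul N)).add (hs0.const_mul N)
    simpa using this
  have hfinal := ge_of_tendsto hlim (b := lam / 2 * W2 μ ν ^ 2) (by
    filter_upwards [Ioc_mem_nhdsGT (zero_lt_one' ℝ)] with s hs using hstep s hs.1 hs.2)
  have : W2 μ ν ^ 2 = 2 / lam * (lam / 2 * W2 μ ν ^ 2) := by field_simp
  rw [this]
  refine (mul_le_mul_of_nonneg_left hfinal (by positivity)).trans_eq ?_
  field_simp
  norm_num

end Contraction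

section Moreau

variable {E : Type*} [NormedAddCommGroup E]

/-- The Moreau–Yosida regularization. -/
noncomputable def moreau (u : E → ℝ) (ε : ℝ) (x : E) : ℝ :=
  ⨅ y, (u y + ‖x - y‖ ^ 2 / (2 * ε))

/-- `p` is a proximal point of `x` for `u` with step `ε`. -/
def IsProx (u : E → ℝ) (ε : ℝ) (x p : E) : Prop :=
  ∀ y, u p + ‖x - p‖ ^ 2 / (2 * ε) ≤ u y + ‖x - y‖ ^ 2 / (2 * ε)

lemma IsProx.moreau_eq {u : E → ℝ} {ε : ℝ} {x p : E} (hp : IsProx u ε x p) :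
    moreau u ε x = u p + ‖x - p‖ ^ 2 / (2 * ε) :=
  le_antisymm (ciInf_le ⟨_, by rintro _ ⟨y, rfl⟩; exact hp y⟩ p) (le_ciInf hp)

lemma IsProx.moreau_le {u : E → ℝ} {ε : ℝ} {x p : E} (hp : IsProx u ε x p) (y : E) :
    moreau u ε x ≤ u y + ‖x - y‖ ^ 2 / (2 * ε) := hp.moreau_eq.trans_le (hp y)

variable [InnerProductSpace ℝ E]

lemma exists_isProx [FiniteDimensional ℝ E] {u : E → ℝ} (hu : Continuous u)
    (hnonneg : ∀ x, 0 ≤ u x) {ε : ℝ} (hε : 0 < ε) (x : E) : ∃ p, IsProx u ε x p := by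
  refine Continuous.exists_forall_le (by fun_prop) ?_
  have h1 : Tendsto (fun y : E => ‖x - y‖) (cocompact E) atTop := by
    refine tendsto_atTop_mono (fun y => ?_)
      (tendsto_atTop_add_const_right _ (-‖x‖) (tendsto_norm_cocompact_atTop (E := E)))
    linarith [norm_le_norm_add_norm_sub x y]
  have h2 : Tendsto (fun y : E => ‖x - y‖ ^ 2 / (2 * ε)) (cocompact E) atTop :=
    ((tendsto_pow_atTop two_ne_zero).comp h1).atTop_div_const (by positivity)
  exact tendsto_atTop_mono (fun y => le_add_of_nonneg_left (hnonneg y)) h2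

variable [CompleteSpace E] {u : E → ℝ} {h : E → E}

lemma IsProx.gradient_eq (hu : ∀ x, HasGradientAt u (h x) x) {ε : ℝ} {x p : E}
    (hp : IsProx u ε x p) (hε : 0 < ε) : ε • h p = x - p := by
  have h1 : HasFDerivAt (fun y : E => x - y) (-ContinuousLinearMap.id ℝ E) p :=
    (hasFDerivAt_id p).const_sub x
  have h2 := (hu p).hasFDerivAt.add (h1.norm_sq.mul_const (2 * ε)⁻¹)
  have h3 : IsLocalMin (u + fun y => ‖x - y‖ ^ 2 * (2 * ε)⁻¹) p :=
    Filter.Eventually.of_forall fun y => by simpa [div_eq_mul_inv] using hp y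
  have h4 := h3.hasFDerivAt_eq_zero h2
  refine ext_inner_right ℝ fun w => ?_
  have h5 := congrArg (fun L : E →L[ℝ] ℝ => L w) h4
  simp at h5
  rw [inner_smul_left]
  simp only [conj_trivial]
  field_simp at h5
  rw [inner_sub_left]
  linarith

lemma IsProx.sq_norm_sub_le (hu : ∀ x, HasGradientAt u (h x) x)
    (hmono : ∀ x y, 0 ≤ inner ℝ (h x - h y) (x - y)) {ε : ℝ} (hε : 0 < ε) {x y p q : E}
    (hp : IsProx u ε x p) (hq : IsProx u ε y q) :
    ‖p - q‖ ^ 2 ≤ inner ℝ (x - y) (p - q) := by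
  have h1 : 0 ≤ inner ℝ (ε • (h p - h q)) (p - q) := by
    rw [real_inner_smul_left]
    exact mul_nonneg hε.le (hmono p q)
  rw [smul_sub, hp.gradient_eq hu hε, hq.gradient_eq hu hε] at h1
  have h2 : x - p - (y - q) = (x - y) - (p - q) := by abel
  rw [h2, inner_sub_left, real_inner_self_eq_norm_sq] at h1
  linarith

lemma IsProx.norm_sub_le (hu : ∀ x, HasGradientAt u (h x) x)
    (hmono : ∀ x y, 0 ≤ inner ℝ (h x - h y) (x - y)) {ε : ℝ} (hε : 0 < ε) {x y p q : E}
    (hp : IsProx u ε x p) (hq : IsProx u ε y q) : ‖p - q‖ ≤ ‖x - y‖ := by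
  have h1 := (hp.sq_norm_sub_le hu hmono hε hq).trans (real_inner_le_norm _ _)
  by_contra! h2
  nlinarith [norm_nonneg (x - y)]

lemma IsProx.moreau_sub_le (hu : ∀ x, HasGradientAt u (h x) x) {ε : ℝ} (hε : 0 < ε)
    {x y p q : E} (hp : IsProx u ε x p) (hq : IsProx u ε y q) :
    moreau u ε y - moreau u ε x ≤ inner ℝ (h p) (y - x) + ‖y - x‖ ^ 2 / (2 * ε) := by
  have h1 := hq.moreau_le p
  have h2 : y - p = (x - p) + (y - x) := by abel
  rw [h2, norm_add_sq_real, ← hp.gradient_eq hu hε, real_inner_smul_left,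
    hp.gradient_eq hu hε] at h1
  rw [hp.moreau_eq]
  have h3 : (‖x - p‖ ^ 2 + 2 * (ε * inner ℝ (h p) (y - x)) + ‖y - x‖ ^ 2) / (2 * ε) =
      ‖x - p‖ ^ 2 / (2 * ε) + inner ℝ (h p) (y - x) + ‖y - x‖ ^ 2 / (2 * ε) := by
    field_simp
  linarith

lemma hasGradientAt_moreau (hu : ∀ x, HasGradientAt u (h x) x)
    (hmono : ∀ x y, 0 ≤ inner ℝ (h x - h y) (x - y)) {ε : ℝ} (hε : 0 < ε) {P : E → E}
    (hP : ∀ x, IsProx u ε x (P x)) (x : E) : HasGradientAt (moreau u ε) (h (P x)) x := by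
  rw [hasGradientAt_iff_isLittleO]
  have hbound : ∀ y, ‖moreau u ε y - moreau u ε x - inner ℝ (h (P x)) (y - x)‖ ≤
      (2 * ε)⁻¹ * ‖‖y - x‖ ^ 2‖ := by
    intro y
    have h1 := (hP x).moreau_sub_le hu hε (hP y)
    have h2 := (hP y).moreau_sub_le hu hε (hP x)
    have h3 : 0 ≤ inner ℝ (ε • (h (P y) - h (P x))) (y - x) := by
      rw [smul_sub, (hP y).gradient_eq hu hε, (hP x).gradient_eq hu hε]
      have h4 : y - P y - (x - P x) = (y - x) - (P y - P x) := by abel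
      have h5 := (hP y).norm_sub_le hu hmono hε (hP x)
      have h6 := real_inner_le_norm (P y - P x) (y - x)
      rw [h4, inner_sub_left, real_inner_self_eq_norm_sq]
      nlinarith [norm_nonneg (y - x)]
    rw [real_inner_smul_left, inner_sub_left] at h3
    have h4 := nonneg_of_mul_nonneg_right h3 hε
    rw [← neg_sub y x, inner_neg_right, norm_neg] at h2
    rw [Real.norm_eq_abs, Real.norm_of_nonneg (sq_nonneg _), abs_le, inv_mul_eq_div]
    constructor <;> linarith
  refine (Asymptotics.IsBigO.of_bound _ (Eventually.of_forall hbound)).trans_isLittleO ?_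
  have h7 : Tendsto (fun y => y - x) (𝓝 x) (𝓝 0) :=
    Continuous.tendsto' (by fun_prop) _ _ (sub_self x)
  exact (Asymptotics.isLittleO_norm_pow_id one_lt_two).comp_tendsto h7

lemma quadratic_lower_bound (hu : ∀ x, HasGradientAt u (h x) x) {m : ℝ}
    (hmono : ∀ x y, 2 * m * ‖x - y‖ ^ 2 ≤ inner ℝ (h x - h y) (x - y)) (p : E) :
    u 0 + inner ℝ (h 0) p + m * ‖p‖ ^ 2 ≤ u p := by
  let ψ : ℝ → ℝ := fun t => u (t • p) - t * inner ℝ (h 0) p - t ^ 2 * (m * ‖p‖ ^ 2)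
  have hψ : ∀ t, HasDerivAt ψ (inner ℝ (h (t • p)) p - inner ℝ (h 0) p -
      2 * t * (m * ‖p‖ ^ 2)) t := by
    intro t
    have h1 : HasDerivAt (fun t : ℝ => t • p) p t := by
      simpa using (hasDerivAt_id t).smul_const p
    have h2 : HasDerivAt (fun t : ℝ => u (t • p)) (inner ℝ (h (t • p)) p) t := by
      convert! (hu (t • p)).hasFDerivAt.comp_hasDerivAt t h1 using 1
    have h3 : HasDerivAt (fun t : ℝ => t * inner ℝ (h 0) p) (inner ℝ (h 0) p) t := by
      simpa using (hasDerivAt_id t).mul_const (inner ℝ (h 0) p)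
    have h4 : HasDerivAt (fun t : ℝ => t ^ 2 * (m * ‖p‖ ^ 2)) (2 * t * (m * ‖p‖ ^ 2)) t := by
      simpa using (hasDerivAt_pow 2 t).mul_const (m * ‖p‖ ^ 2)
    exact (h2.sub h3).sub h4
  have hmon : MonotoneOn ψ (Set.Icc 0 1) := by
    refine monotoneOn_of_deriv_nonneg (convex_Icc 0 1)
      (fun t _ => (hψ t).continuousAt.continuousWithinAt)
      (fun t _ => (hψ t).differentiableAt.differentiableWithinAt) fun t ht => ?_
    rw [interior_Icc] at ht
    rw [(hψ t).deriv]
    have h5 := hmono (t • p) 0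
    rw [sub_zero, inner_sub_left, inner_smul_right, inner_smul_right, norm_smul, mul_pow,
      Real.norm_eq_abs, sq_abs] at h5
    have h6 : 0 ≤ t * (inner ℝ (h (t • p)) p - inner ℝ (h 0) p - 2 * t * (m * ‖p‖ ^ 2)) := by
      nlinarith
    exact nonneg_of_mul_nonneg_right h6 ht.1
  have := hmon (by simp) (by simp) zero_le_one
  simp only [ψ, zero_smul, one_smul] at this
  linarith

lemma quadratic_lower_bound' (hu : ∀ x, HasGradientAt u (h x) x) (hnonneg : ∀ x, 0 ≤ u x)
    {m : ℝ} (hm : 0 < m)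
    (hmono : ∀ x y, 2 * m * ‖x - y‖ ^ 2 ≤ inner ℝ (h x - h y) (x - y)) (p : E) :
    m / 2 * ‖p‖ ^ 2 - ‖h 0‖ ^ 2 / (2 * m) ≤ u p := by
  have h1 := quadratic_lower_bound hu hmono p
  have h2 := neg_le_of_abs_le (abs_real_inner_le_norm (h 0) p)
  have h3 : ‖h 0‖ * ‖p‖ ≤ m / 2 * ‖p‖ ^ 2 + ‖h 0‖ ^ 2 / (2 * m) := by
    have h4 : m / 2 * ‖p‖ ^ 2 + ‖h 0‖ ^ 2 / (2 * m) - ‖h 0‖ * ‖p‖ =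
        (m * ‖p‖ - ‖h 0‖) ^ 2 / (2 * m) := by field_simp; ring
    have h5 : 0 ≤ (m * ‖p‖ - ‖h 0‖) ^ 2 / (2 * m) := by positivity
    linarith
  linarith [hnonneg 0]

lemma moreau_lower_bound (hu : ∀ x, HasGradientAt u (h x) x) (hnonneg : ∀ x, 0 ≤ u x)
    {m : ℝ} (hm : 0 < m)
    (hmono : ∀ x y, 2 * m * ‖x - y‖ ^ 2 ≤ inner ℝ (h x - h y) (x - y)) {ε : ℝ} (hε : 0 < ε)
    (hεm : ε < 1 / m) (x : E) :
    m / 4 * ‖x‖ ^ 2 - ‖h 0‖ ^ 2 / (2 * m) ≤ moreau u ε x := by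
  refine le_ciInf fun p => ?_
  have h1 := quadratic_lower_bound' hu hnonneg hm hmono p
  have h2 : m / 2 * ‖x - p‖ ^ 2 ≤ ‖x - p‖ ^ 2 / (2 * ε) := by
    rw [le_div_iff₀ (by positivity)]
    rw [lt_div_iff₀ hm] at hεm
    nlinarith [sq_nonneg ‖x - p‖]
  have h3 := norm_le_norm_add_norm_sub' x p
  have h4 : ‖x‖ ^ 2 ≤ (‖p‖ + ‖x - p‖) ^ 2 := pow_le_pow_left₀ (norm_nonneg _) h3 2
  nlinarith [mul_nonneg hm.le (sq_nonneg (‖p‖ - ‖x - p‖)), mul_le_mul_of_nonneg_left h4 hm.le]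

lemma IsProx.norm_le (hu : ∀ x, HasGradientAt u (h x) x)
    (hmono : ∀ x y, 0 ≤ inner ℝ (h x - h y) (x - y)) {ε : ℝ} (hε : 0 < ε) {x p : E}
    (hp : IsProx u ε x p) : ‖p‖ ≤ ‖x‖ + ε * ‖h 0‖ := by
  have h1 := mul_nonneg hε.le (hmono p 0)
  rw [sub_zero, ← real_inner_smul_left, smul_sub, hp.gradient_eq hu hε, sub_right_comm,
    inner_sub_left, real_inner_self_eq_norm_sq] at h1
  have h2 := (real_inner_le_norm (x - ε • h 0) p).trans
    (mul_le_mul_of_nonneg_right (_root_.norm_sub_le _ _) (norm_nonneg _))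
  rw [norm_smul, Real.norm_of_nonneg hε.le] at h2
  by_contra! h3
  have h4 : 0 ≤ ‖x‖ + ε * ‖h 0‖ := by positivity
  nlinarith [norm_nonneg p]

end Moreau

section Moments

lemma gibbs_density_mul_pow_le {E : Type*} [NormedAddCommGroup E] {c κ K : ℝ} (hc : 0 ≤ c)
    {f : E → ℝ} (hlow : ∀ x, κ * ‖x‖ ^ 2 - K ≤ f x) (n : ℕ) (x : E) :
    c * Real.exp (-f x) * (1 + ‖x‖) ^ n ≤
      c * Real.exp K * ((1 + ‖x‖) ^ n * Real.exp (-(κ * ‖x‖ ^ 2))) := by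
  have h1 : Real.exp (-f x) ≤ Real.exp K * Real.exp (-(κ * ‖x‖ ^ 2)) := by
    rw [← Real.exp_add]
    exact Real.exp_le_exp.2 (by linarith [hlow x])
  calc _ ≤ c * (Real.exp K * Real.exp (-(κ * ‖x‖ ^ 2))) * (1 + ‖x‖) ^ n := by gcongr
    _ = _ := by ring

lemma isProbabilityMeasure_left_of_prod {E : Type*} [MeasurableSpace E] {μ γ : Measure E}
    [IsProbabilityMeasure γ] (h : IsProbabilityMeasure (μ.prod γ)) : IsProbabilityMeasure μ := by
  constructor
  have h1 := h.measure_univ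
  rwa [← Set.univ_prod_univ, Measure.prod_prod, measure_univ (μ := γ), mul_one] at h1

variable {E : Type*} [NormedAddCommGroup E] [InnerProductSpace ℝ E] [FiniteDimensional ℝ E]
  [MeasurableSpace E] [BorelSpace E]

lemma integrable_exp_neg_mul_sq_norm {κ : ℝ} (hκ : 0 < κ) :
    Integrable (fun x : E => Real.exp (-(κ * ‖x‖ ^ 2))) := by
  have := (GaussianFourier.integrable_cexp_neg_mul_sq_norm_add (V := E) (b := κ)
    (by simpa using hκ) 0 0).norm
  refine this.congr (ae_of_all _ fun x => ?_)
  simp [Complex.norm_exp, ← Complex.ofReal_pow]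

lemma integrable_pow_mul_exp_neg_mul_sq_norm {κ : ℝ} (hκ : 0 < κ) (n : ℕ) :
    Integrable (fun x : E => (1 + ‖x‖) ^ n * Real.exp (-(κ * ‖x‖ ^ 2))) := by
  refine ((integrable_exp_neg_mul_sq_norm (E := E) (half_pos hκ)).const_mul
    (n.factorial * Real.exp (1 + 1 / (2 * κ)))).mono'
    (Continuous.aestronglyMeasurable (by fun_prop)) (ae_of_all _ fun x => ?_)
  rw [Real.norm_of_nonneg (by positivity)]
  have h1 := Real.pow_div_factorial_le_exp (1 + ‖x‖) (by positivity) n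
  rw [div_le_iff₀ (by positivity)] at h1
  calc (1 + ‖x‖) ^ n * Real.exp (-(κ * ‖x‖ ^ 2))
      ≤ Real.exp (1 + ‖x‖) * n.factorial * Real.exp (-(κ * ‖x‖ ^ 2)) := by gcongr
    _ = n.factorial * Real.exp (1 + ‖x‖ + -(κ * ‖x‖ ^ 2)) := by rw [Real.exp_add (1 + ‖x‖)]; ring
    _ ≤ n.factorial * Real.exp (1 + 1 / (2 * κ) + -(κ / 2 * ‖x‖ ^ 2)) := by
        refine mul_le_mul_of_nonneg_left (Real.exp_le_exp.2 ?_) (by positivity)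
        have h2 : 1 + 1 / (2 * κ) + -(κ / 2 * ‖x‖ ^ 2) - (1 + ‖x‖ + -(κ * ‖x‖ ^ 2)) =
            (κ * ‖x‖ - 1) ^ 2 / (2 * κ) := by field_simp; ring
        have h3 : 0 ≤ (κ * ‖x‖ - 1) ^ 2 / (2 * κ) := by positivity
        linarith
    _ = _ := by rw [Real.exp_add]; ring

lemma integrable_gibbs_iff {c : ℝ} (hc : 0 ≤ c) {f : E → ℝ} (hf : Measurable f) {φ : E → ℝ} :
    Integrable φ (gibbs c f) ↔ Integrable (fun x => c * Real.exp (-f x) * φ x) := by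
  rw [gibbs, integrable_withDensity_iff_integrable_smul' (by fun_prop) (by simp)]
  refine integrable_congr (ae_of_all _ fun x => ?_)
  simp only [smul_eq_mul]
  rw [ENNReal.toReal_ofReal (by positivity)]

lemma integral_gibbs {c : ℝ} (hc : 0 ≤ c) {f : E → ℝ} (hf : Measurable f) (φ : E → ℝ) :
    ∫ x, φ x ∂gibbs c f = ∫ x, c * Real.exp (-f x) * φ x := by
  rw [gibbs, integral_withDensity_eq_integral_toReal_smul (by fun_prop) (by simp)]
  refine integral_congr_ae (ae_of_all _ fun x => ?_)
  simp only [smul_eq_mul]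
  rw [ENNReal.toReal_ofReal (by positivity)]

lemma integrable_pow_gibbs {c κ K : ℝ} (hc : 0 ≤ c) (hκ : 0 < κ) {f : E → ℝ} (hf : Continuous f)
    (hlow : ∀ x, κ * ‖x‖ ^ 2 - K ≤ f x) (n : ℕ) :
    Integrable (fun x => (1 + ‖x‖) ^ n) (gibbs c f) := by
  rw [integrable_gibbs_iff hc hf.measurable]
  refine ((integrable_pow_mul_exp_neg_mul_sq_norm hκ n).const_mul (c * Real.exp K)).mono'
    (Continuous.aestronglyMeasurable (by fun_prop)) (ae_of_all _ fun x => ?_)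
  rw [Real.norm_of_nonneg (by positivity)]
  exact gibbs_density_mul_pow_le hc hlow n x

lemma integral_pow_gibbs_le {c κ K : ℝ} (hc : 0 ≤ c) (hκ : 0 < κ) {f : E → ℝ}
    (hf : Continuous f) (hlow : ∀ x, κ * ‖x‖ ^ 2 - K ≤ f x) (n : ℕ) :
    ∫ x, (1 + ‖x‖) ^ n ∂gibbs c f ≤
      c * Real.exp K * ∫ x : E, (1 + ‖x‖) ^ n * Real.exp (-(κ * ‖x‖ ^ 2)) := by
  have h1 := integrable_pow_gibbs hc hκ hf hlow n
  rw [integrable_gibbs_iff hc hf.measurable] at h1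
  rw [integral_gibbs hc hf.measurable, ← integral_const_mul]
  exact integral_mono h1 ((integrable_pow_mul_exp_neg_mul_sq_norm hκ n).const_mul _)
    (gibbs_density_mul_pow_le hc hlow n)

/-- A larger potential needs a larger normalizing factor. -/
lemma gibbs_const_le {c c' : ℝ} (hc : 0 < c) (hc' : 0 ≤ c') {f g : E → ℝ} (hf : Measurable f)
    (hg : Measurable g) (hgf : ∀ x, g x ≤ f x) [IsProbabilityMeasure (gibbs c f)]
    [IsProbabilityMeasure (gibbs c' g)] : c' ≤ c := by
  have h1 : ∫⁻ _, 1 ∂gibbs c f = 1 := by simp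
  have h2 : ∫⁻ _, 1 ∂gibbs c' g = 1 := by simp
  rw [lintegral_gibbs hf measurable_const] at h1
  rw [lintegral_gibbs hg measurable_const] at h2
  have h3 : ENNReal.ofReal (c' / c) * 1 ≤ 1 := by
    conv_lhs => rw [← h1]
    rw [← lintegral_const_mul _ (by fun_prop)]
    refine le_of_le_of_eq (lintegral_mono fun x => ?_) h2
    rw [mul_one, mul_one, ← ENNReal.ofReal_mul (by positivity)]
    refine ENNReal.ofReal_le_ofReal ?_
    rw [← mul_assoc, div_mul_cancel₀ _ hc.ne']
    have := hgf x
    gcongr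
  rw [mul_one, ENNReal.ofReal_le_one, div_le_one hc] at h3
  exact h3

/-- A Gibbs measure whose potential splits over two factors is a product, with any prescribed
normalization of the second factor. -/
lemma gibbs_prod_gibbs {c c₂ : ℝ} (hc : 0 ≤ c) (hc₂ : 0 < c₂) {f g : E → ℝ} (hf : Measurable f)
    (hg : Measurable g) :
    (gibbs (c / c₂) f).prod (gibbs c₂ g) = volume.withDensity
      (fun p : E × E => ENNReal.ofReal (c * Real.exp (-(f p.1 + g p.2)))) := by
  rw [gibbs, gibbs, prod_withDensity (by fun_prop) (by fun_prop), Measure.volume_eq_prod]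
  congr 1
  ext p
  rw [← ENNReal.ofReal_mul (by positivity), neg_add, Real.exp_add]
  congr 1
  field_simp

lemma withDensity_kinetic_eq_gibbs_prod {β c c₂ : ℝ} (hc : 0 ≤ c) (hc₂ : 0 < c₂) {f : E → ℝ}
    (hf : Measurable f) :
    volume.withDensity (fun p : E × E =>
      ENNReal.ofReal (c * Real.exp (-β * (f p.1 + ‖p.2‖ ^ 2 / 2)))) =
    (gibbs (c / c₂) fun x => β * f x).prod (gibbs c₂ fun v => β / 2 * ‖v‖ ^ 2) := by
  rw [gibbs_prod_gibbs hc hc₂ (by fun_prop) (by fun_prop)]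
  congr 1
  funext p
  congr 3
  ring

lemma exists_isProbabilityMeasure_gibbs {κ : ℝ} (hκ : 0 < κ) :
    ∃ c, 0 < c ∧ IsProbabilityMeasure (gibbs c fun x : E => κ * ‖x‖ ^ 2) := by
  have hint := integrable_exp_neg_mul_sq_norm (E := E) hκ
  have hpos : 0 < ∫ x : E, Real.exp (-(κ * ‖x‖ ^ 2)) := integral_exp_pos hint
  refine ⟨(∫ x : E, Real.exp (-(κ * ‖x‖ ^ 2)))⁻¹, inv_pos.2 hpos, ⟨?_⟩⟩
  rw [gibbs, withDensity_apply _ MeasurableSet.univ, Measure.restrict_univ,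
    ← ofReal_integral_eq_lintegral_ofReal (hint.const_mul _) (ae_of_all _ fun x => by positivity),
    integral_const_mul, inv_mul_cancel₀ hpos.ne', ENNReal.ofReal_one]

end Moments

section Regularization

variable {E : Type*} [NormedAddCommGroup E] {u : E → ℝ} {h : E → E}
  {m L : ℝ} {N : ℕ}

lemma norm_le_of_lipschitz_pow (hL : 0 ≤ L)
    (hlip : ∀ x y, ‖h x - h y‖ ≤ L * (1 + ‖x‖ + ‖y‖) ^ N * ‖x - y‖) (x : E) :
    ‖h x‖ ≤ (‖h 0‖ + L) * (1 + ‖x‖) ^ (N + 1) := by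
  have h1 := hlip x 0
  rw [norm_zero, add_zero, sub_zero] at h1
  have h2 := norm_le_norm_add_norm_sub' (h x) (h 0)
  have h3 : 1 ≤ (1 + ‖x‖) ^ (N + 1) := one_le_pow₀ (by linarith [norm_nonneg x])
  have h4 : L * (1 + ‖x‖) ^ N * ‖x‖ ≤ L * (1 + ‖x‖) ^ (N + 1) := by
    rw [pow_succ, ← mul_assoc]
    gcongr
    linarith
  nlinarith [norm_nonneg (h 0)]

variable [InnerProductSpace ℝ E] [CompleteSpace E]

lemma IsProx.one_add_norm_le (hu : ∀ x, HasGradientAt u (h x) x)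
    (hmono : ∀ x y, 0 ≤ inner ℝ (h x - h y) (x - y)) {ε : ℝ} (hε : 0 < ε) (hεm : ε < 1 / m)
    {x p : E} (hp : IsProx u ε x p) : 1 + ‖p‖ ≤ (1 + ‖h 0‖ / m) * (1 + ‖x‖) := by
  have h1 := hp.norm_le hu hmono hε
  have h2 : ε * ‖h 0‖ ≤ ‖h 0‖ / m := by
    rw [div_eq_mul_one_div, mul_comm]
    gcongr
  have h3 : 0 ≤ ‖h 0‖ / m := (by positivity : 0 ≤ ε * ‖h 0‖).trans h2
  nlinarith [norm_nonneg x]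

lemma IsProx.norm_gradient_le (hu : ∀ x, HasGradientAt u (h x) x)
    (hmono : ∀ x y, 0 ≤ inner ℝ (h x - h y) (x - y)) (hL : 0 ≤ L)
    (hlip : ∀ x y, ‖h x - h y‖ ≤ L * (1 + ‖x‖ + ‖y‖) ^ N * ‖x - y‖) {ε : ℝ} (hε : 0 < ε)
    (hεm : ε < 1 / m) {x p : E} (hp : IsProx u ε x p) :
    ‖h p‖ ≤ (‖h 0‖ + L) * (1 + ‖h 0‖ / m) ^ (N + 1) * (1 + ‖x‖) ^ (N + 1) := by
  rw [mul_assoc, ← mul_pow]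
  refine (norm_le_of_lipschitz_pow hL hlip p).trans ?_
  gcongr
  exact hp.one_add_norm_le hu hmono hε hεm

lemma IsProx.norm_gradient_sub_le (hu : ∀ x, HasGradientAt u (h x) x)
    (hmono : ∀ x y, 0 ≤ inner ℝ (h x - h y) (x - y)) (hL : 0 ≤ L)
    (hlip : ∀ x y, ‖h x - h y‖ ≤ L * (1 + ‖x‖ + ‖y‖) ^ N * ‖x - y‖) {ε : ℝ} (hε : 0 < ε)
    (hεm : ε < 1 / m) {x p : E} (hp : IsProx u ε x p) :
    ‖h x - h p‖ ≤ ε * (L * (2 + ‖h 0‖ / m) ^ N *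
      ((‖h 0‖ + L) * (1 + ‖h 0‖ / m) ^ (N + 1))) * (1 + ‖x‖) ^ (2 * N + 1) := by
  have h1 := hp.norm_gradient_le hu hmono hL hlip hε hεm
  have h2 : 1 + ‖x‖ + ‖p‖ ≤ (2 + ‖h 0‖ / m) * (1 + ‖x‖) := by
    linarith [hp.one_add_norm_le hu hmono hε hεm]
  have h3 : ‖x - p‖ = ε * ‖h p‖ := by
    rw [← hp.gradient_eq hu hε, norm_smul, Real.norm_of_nonneg hε.le]
  calc ‖h x - h p‖ ≤ L * (1 + ‖x‖ + ‖p‖) ^ N * (ε * ‖h p‖) := h3 ▸ hlip x p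
    _ ≤ L * ((2 + ‖h 0‖ / m) * (1 + ‖x‖)) ^ N *
        (ε * ((‖h 0‖ + L) * (1 + ‖h 0‖ / m) ^ (N + 1) * (1 + ‖x‖) ^ (N + 1))) := by
        refine mul_le_mul (by gcongr) (by gcongr) (by positivity) (mul_nonneg hL (pow_nonneg ?_ _))
        exact le_trans (by positivity) h2
    _ = _ := by rw [mul_pow]; ring

lemma HasGradientAt.const_mul_real {f : E → ℝ} {f' x : E} (hf : HasGradientAt f f' x) (β : ℝ) :
    HasGradientAt (fun x => β * f x) (β • f') x := by
  rw [hasGradientAt_iff_hasFDerivAt, map_smul]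
  exact hf.hasFDerivAt.const_mul β

lemma HasPolyGradient.const_mul {f : E → ℝ} {F : E → E} {C : ℝ} {k : ℕ}
    (hF : HasPolyGradient f F C k) {β : ℝ} (hβ : 0 ≤ β) :
    HasPolyGradient (fun x => β * f x) (fun x => β • F x) (β * C) k where
  hasGradientAt x := (hF.hasGradientAt x).const_mul_real β
  continuous_gradient := hF.continuous_gradient.const_smul β
  norm_le x := by
    rw [norm_smul, Real.norm_of_nonneg hβ, mul_assoc]
    exact mul_le_mul_of_nonneg_left (hF.norm_le x) hβ

variable [FiniteDimensional ℝ E] [MeasurableSpace E] [BorelSpace E]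

/-- The Gibbs measures of a strongly convex potential and of its Moreau–Yosida regularization are
at distance `O(ε)`. -/
theorem exists_W2_gibbs_moreau_le (hu : ∀ x, HasGradientAt u (h x) x) (hh : Continuous h)
    (hnonneg : ∀ x, 0 ≤ u x) (hm : 0 < m) (hL : 0 ≤ L)
    (hmono : ∀ x y, 2 * m * ‖x - y‖ ^ 2 ≤ inner ℝ (h x - h y) (x - y))
    (hlip : ∀ x y, ‖h x - h y‖ ≤ L * (1 + ‖x‖ + ‖y‖) ^ N * ‖x - y‖) {β : ℝ} (hβ : 0 < β)
    {c : ℝ} (hc : 0 < c) (hprob : IsProbabilityMeasure (gibbs c fun x => β * u x)) :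
    ∃ D, 0 < D ∧ ∀ ε, 0 < ε → ε < 1 / m → ∀ c', 0 ≤ c' →
      IsProbabilityMeasure (gibbs c' fun x => β * moreau u ε x) →
      W2 (gibbs c fun x => β * u x) (gibbs c' fun x => β * moreau u ε x) ≤ D * ε := by
  have hmono0 : ∀ x y, 0 ≤ inner ℝ (h x - h y) (x - y) := fun x y =>
    (by positivity : 0 ≤ 2 * m * ‖x - y‖ ^ 2).trans (hmono x y)
  have hucont : Continuous u :=
    continuous_iff_continuousAt.2 fun x => (hu x).differentiableAt.continuousAt
  have hF := HasPolyGradient.const_mul ⟨hu, hh, norm_le_of_lipschitz_pow hL hlip⟩ hβ.le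
  set κ := β * (m / 4) with hκ
  have hκpos : 0 < κ := by positivity
  set K := β * (‖h 0‖ ^ 2 / (2 * m)) with hK
  have hlow : ∀ x, κ * ‖x‖ ^ 2 - K ≤ β * u x := by
    intro x
    have h1 := quadratic_lower_bound' hu hnonneg hm hmono x
    have h2 : m / 4 * ‖x‖ ^ 2 - ‖h 0‖ ^ 2 / (2 * m) ≤ u x := by nlinarith [sq_nonneg ‖x‖]
    rw [hκ, hK, mul_assoc, ← mul_sub]
    exact mul_le_mul_of_nonneg_left h2 hβ.le
  set A := L * (2 + ‖h 0‖ / m) ^ N * ((‖h 0‖ + L) * (1 + ‖h 0‖ / m) ^ (N + 1)) with hA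
  set I := ∫ x : E, (1 + ‖x‖) ^ (2 * (2 * N + 1)) * Real.exp (-(κ * ‖x‖ ^ 2)) with hI
  have hI0 : 0 ≤ I := integral_nonneg fun x => by positivity
  set M := 1 / (2 * (m * β) ^ 2) * ((β * A) ^ 2 * (c * Real.exp K * I)) with hM
  have hM0 : 0 ≤ M := by positivity
  refine ⟨Real.sqrt M + 1, by positivity, fun ε hε hεm c' hc' hprob' => ?_⟩
  choose P hP using exists_isProx hucont hnonneg hε
  have hPcont : Continuous P :=
    (LipschitzWith.of_dist_le_mul (K := 1) fun x y => by
      simpa [dist_eq_norm] using (hP x).norm_sub_le hu hmono0 hε (hP y)).continuous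
  have hG := HasPolyGradient.const_mul (f := moreau u ε) ⟨hasGradientAt_moreau hu hmono0 hε hP,
    hh.comp hPcont, fun x => (hP x).norm_gradient_le hu hmono0 hL hlip hε hεm⟩ hβ.le
  have hlow' : ∀ x, κ * ‖x‖ ^ 2 - K ≤ β * moreau u ε x := by
    intro x
    rw [hκ, hK, mul_assoc, ← mul_sub]
    exact mul_le_mul_of_nonneg_left
      (moreau_lower_bound hu hnonneg hm hmono hε hεm x) hβ.le
  have hcc' : c' ≤ c := gibbs_const_le hc hc' hF.continuous.measurable hG.continuous.measurable
    fun x => mul_le_mul_of_nonneg_left (by simpa using (hP x).moreau_le x) hβ.le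
  have hdiff : ∀ x, ‖β • h x - β • h (P x)‖ ^ 2 ≤
      (β * A) ^ 2 * ε ^ 2 * (1 + ‖x‖) ^ (2 * (2 * N + 1)) := by
    intro x
    have h1 := (hP x).norm_gradient_sub_le hu hmono0 hL hlip hε hεm
    rw [← smul_sub, norm_smul, Real.norm_of_nonneg hβ.le]
    calc (β * ‖h x - h (P x)‖) ^ 2 ≤ (β * (ε * A * (1 + ‖x‖) ^ (2 * N + 1))) ^ 2 := by gcongr
      _ = _ := by ring
  have hmom := integrable_pow_gibbs hc' hκpos hG.continuous hlow'
  have hbound := (hmom (2 * (2 * N + 1))).const_mul ((β * A) ^ 2 * ε ^ 2)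
  have hint : Integrable (fun x => ‖β • h x - β • h (P x)‖ ^ 2)
      (gibbs c' fun x => β * moreau u ε x) := by
    refine hbound.mono' (Continuous.aestronglyMeasurable (by fun_prop)) (ae_of_all _ fun x => ?_)
    rw [Real.norm_of_nonneg (by positivity)]
    exact hdiff x
  have hmonoF : ∀ x y, 2 * (m * β) * ‖x - y‖ ^ 2 ≤ inner ℝ (β • h x - β • h y) (x - y) := by
    intro x y
    rw [← smul_sub, real_inner_smul_left]
    nlinarith [hmono x y]
  have hW := W2_gibbs_sq_le hF hG (mul_pos hm hβ) hmonoF hc.le hc'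
    (integrable_pow_gibbs hc.le hκpos hF.continuous hlow) hmom hint
  have hsq : W2 (gibbs c fun x => β * u x) (gibbs c' fun x => β * moreau u ε x) ^ 2 ≤
      M * ε ^ 2 := by
    refine hW.trans ?_
    have h1 : ∫ x, ‖β • h x - β • h (P x)‖ ^ 2 ∂(gibbs c' fun x => β * moreau u ε x) ≤
        (β * A) ^ 2 * ε ^ 2 * (c * Real.exp K * I) := by
      refine (integral_mono hint hbound hdiff).trans ?_
      rw [integral_const_mul]
      refine mul_le_mul_of_nonneg_left ?_ (by positivity)
      refine (integral_pow_gibbs_le hc' hκpos hG.continuous hlow' _).trans ?_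
      gcongr
    calc _ ≤ 1 / (2 * (m * β) ^ 2) * ((β * A) ^ 2 * ε ^ 2 * (c * Real.exp K * I)) := by gcongr
      _ = _ := by rw [hM]; ring
  have h2 := Real.abs_le_sqrt hsq
  rw [Real.sqrt_mul hM0, Real.sqrt_sq hε.le] at h2
  linarith [le_abs_self (W2 (gibbs c fun x => β * u x) (gibbs c' fun x => β * moreau u ε x))]

end Regularization

theorem stmt_7 (d : ℕ) (hd : 1 ≤ d) (m L l β : ℝ)
    (hm : 0 < m) (hL : 0 < L) (hl : 0 < l) (hβ : 0 < β)
    (u : EuclideanSpace ℝ (Fin d) → ℝ) (hu : ContDiff ℝ 2 u)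
    (hnonneg : ∀ x, 0 ≤ u x)
    (hA1 : ∀ x y : EuclideanSpace ℝ (Fin d),
      ⟪gradient u x - gradient u y, x - y⟫ ≥ 2 * m * ‖x - y‖ ^ 2)
    (hA2 : ∀ x y : EuclideanSpace ℝ (Fin d),
      ‖gradient u x - gradient u y‖ ≤ L * (1 + ‖x‖ + ‖y‖) ^ l * ‖x - y‖)
    (pib : Measure (EuclideanSpace ℝ (Fin d) × EuclideanSpace ℝ (Fin d)))
    (hpibprob : IsProbabilityMeasure pib)
    (hpib : ∃ c : ℝ, 0 < c ∧ pib = volume.withDensity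
      (fun p => ENNReal.ofReal (c * Real.exp (-β * (u p.1 + ‖p.2‖ ^ 2 / 2)))))
    (pibE : ℝ → Measure (EuclideanSpace ℝ (Fin d) × EuclideanSpace ℝ (Fin d)))
    (hpibE : ∀ ε : ℝ, 0 < ε → ε < 1 / m →
      IsProbabilityMeasure (pibE ε) ∧
      ∃ c : ℝ, 0 < c ∧ pibE ε = volume.withDensity
        (fun p => ENNReal.ofReal (c * Real.exp (-β *
          ((⨅ y : EuclideanSpace ℝ (Fin d), (u y + ‖p.1 - y‖ ^ 2 / (2 * ε)))
            + ‖p.2‖ ^ 2 / 2))))) :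
    ∃ cbar : ℝ, 0 < cbar ∧ ∀ ε : ℝ, 0 < ε → ε < 1 / m →
      W2 pib (pibE ε) ≤ cbar * ε := by
  have hdiff : ∀ x, HasGradientAt u (gradient u x) x := fun x =>
    (hu.differentiable two_ne_zero x).hasGradientAt
  have hcont : Continuous (gradient u) :=
    (InnerProductSpace.toDual ℝ _).symm.continuous.comp (hu.continuous_fderiv two_ne_zero)
  have hlip : ∀ x y, ‖gradient u x - gradient u y‖ ≤
      L * (1 + ‖x‖ + ‖y‖) ^ ⌈l⌉₊ * ‖x - y‖ := by
    intro x y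
    refine (hA2 x y).trans ?_
    gcongr
    rw [← Real.rpow_natCast]
    exact Real.rpow_le_rpow_of_exponent_le (by linarith [norm_nonneg x, norm_nonneg y])
      (Nat.le_ceil l)
  obtain ⟨c₂, hc₂, hγ⟩ :=
    exists_isProbabilityMeasure_gibbs (E := EuclideanSpace ℝ (Fin d)) (half_pos hβ)
  obtain ⟨c, hc, rfl⟩ := hpib
  rw [withDensity_kinetic_eq_gibbs_prod hc.le hc₂ hu.continuous.measurable] at hpibprob ⊢
  have hμ := isProbabilityMeasure_left_of_prod hpibprob
  obtain ⟨D, hD, hW⟩ := exists_W2_gibbs_moreau_le hdiff hcont hnonneg hm hL.le hA1 hlip hβ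
    (div_pos hc hc₂) hμ
  refine ⟨D, hD, fun ε hε hεm => ?_⟩
  obtain ⟨hprob, c', hc', hE⟩ := hpibE ε hε hεm
  choose P hP using exists_isProx hu.continuous hnonneg hε
  have hmoreau : Continuous (moreau u ε) := continuous_iff_continuousAt.2 fun x =>
    (hasGradientAt_moreau hdiff (fun x y =>
      (by positivity : 0 ≤ 2 * m * ‖x - y‖ ^ 2).trans (hA1 x y)) hε hP
        x).differentiableAt.continuousAt
  have hE' := withDensity_kinetic_eq_gibbs_prod (β := β) hc'.le hc₂ hmoreau.measurable
  simp only [moreau] at hE'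
  rw [hE, hE'] at hprob
  rw [hE, hE']
  have hν := isProbabilityMeasure_left_of_prod hprob
  exact (W2_prod_right_le _ _ _).trans (hW ε hε hεm _ (by positivity) hν)
end

section
/- Under Assumptions (A1)–(A2) with u ≥ 0, let x* be the global minimizer of u. Then for every β > 0, ∫_{ℝ^d} |x − x*|² dμ_β(x) ≤ 2d/(mβ). -/
open MeasureTheory Real

local notation "⟪" x ", " y "⟫" => @inner ℝ _ _ x y

/-- Along a segment issuing from a minimizer `a`, a function with `2m`-strongly monotone gradient
grows at least quadratically. -/
theorem add_sq_le_of_strongly_monotone_gradient {E : Type*} [NormedAddCommGroup E]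
    [InnerProductSpace ℝ E] [CompleteSpace E] {m s : ℝ} (hm : 0 < m) {u : E → ℝ}
    (hu : Differentiable ℝ u)
    (hmono : ∀ x y : E, 2 * m * ‖x - y‖ ^ 2 ≤ ⟪gradient u x - gradient u y, x - y⟫)
    {a : E} (ha : ∀ y, u a ≤ u y) (hs : 1 / 2 ≤ s) (hs1 : s < 1) (x : E) :
    u (a + s • (x - a)) + m * (1 - s) * ‖x - a‖ ^ 2 ≤ u x := by
  have hgrad : gradient u a = 0 := by
    have hmin : IsLocalMin u a := Filter.Eventually.of_forall ha
    simp [gradient, hmin.fderiv_eq_zero]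
  have hderiv : ∀ t : ℝ, HasDerivAt (fun t : ℝ => u (a + t • (x - a)))
      ⟪gradient u (a + t • (x - a)), x - a⟫ t := by
    intro t
    have hline : HasDerivAt (fun t : ℝ => a + t • (x - a)) (x - a) t := by
      simpa using ((hasDerivAt_id t).smul_const (x - a)).const_add a
    exact (hu _).hasGradientAt.hasFDerivAt.comp_hasDerivAt t hline
  obtain ⟨ξ, ⟨hξs, -⟩, hξ⟩ := exists_hasDerivAt_eq_slope _ _ hs1
    (fun t _ => (hderiv t).continuousAt.continuousWithinAt) (fun t _ => hderiv t)
  have hξ0 : 0 < ξ := by linarith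
  have hinner : 2 * m * ξ * ‖x - a‖ ^ 2 ≤ ⟪gradient u (a + ξ • (x - a)), x - a⟫ := by
    have h := hmono (a + ξ • (x - a)) a
    rw [hgrad, sub_zero, add_sub_cancel_left, inner_smul_right, norm_smul, mul_pow,
      Real.norm_eq_abs, sq_abs] at h
    refine le_of_mul_le_mul_left ?_ hξ0
    linarith
  have hlow : m * ‖x - a‖ ^ 2 ≤ 2 * m * ξ * ‖x - a‖ ^ 2 := by
    gcongr
    nlinarith
  rw [eq_div_iff (by linarith), one_smul, add_sub_cancel] at hξ
  nlinarith [mul_le_mul_of_nonneg_right (hlow.trans hinner) (sub_nonneg.2 hs1.le)]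

/-- Change of variables for the Lebesgue integral under a homothety. -/
theorem lintegral_comp_homothety {E : Type*} [NormedAddCommGroup E] [NormedSpace ℝ E]
    [MeasurableSpace E] [BorelSpace E] [FiniteDimensional ℝ E] (ν : Measure E)
    [ν.IsAddHaarMeasure] {s : ℝ} (hs : 0 < s) (a : E) {f : E → ENNReal} (hf : Measurable f) :
    ∫⁻ x, f (a + s • (x - a)) ∂ν =
      ENNReal.ofReal ((s ^ Module.finrank ℝ E)⁻¹) * ∫⁻ x, f x ∂ν := by
  rw [lintegral_sub_right_eq_self (fun x => f (a + s • x)) a,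
    ← lintegral_map (f := fun x => f (a + x)) (g := fun x => s • x) (by fun_prop) (by fun_prop),
    Measure.map_addHaar_smul ν hs.ne', lintegral_smul_measure,
    lintegral_add_left_eq_self f a, abs_of_nonneg (by positivity), smul_eq_mul]

theorem stmt_18 (d : ℕ) (hd : 1 ≤ d) (m L l : ℝ)
    (hm : 0 < m) (hL : 0 < L) (hl : 0 < l)
    (u : EuclideanSpace ℝ (Fin d) → ℝ) (hu : ContDiff ℝ 2 u)
    (hnonneg : ∀ x, 0 ≤ u x)
    (hA1 : ∀ x y : EuclideanSpace ℝ (Fin d),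
      ⟪gradient u x - gradient u y, x - y⟫ ≥ 2 * m * ‖x - y‖ ^ 2)
    (hA2 : ∀ x y : EuclideanSpace ℝ (Fin d),
      ‖gradient u x - gradient u y‖ ≤ L * (1 + ‖x‖ + ‖y‖) ^ l * ‖x - y‖)
    (xs : EuclideanSpace ℝ (Fin d)) (hxs : ∀ y, u xs ≤ u y) :
    ∀ β : ℝ, 0 < β →
      ∀ μ : Measure (EuclideanSpace ℝ (Fin d)), IsProbabilityMeasure μ →
        (∃ c : ℝ, 0 < c ∧ μ = volume.withDensity
          (fun x => ENNReal.ofReal (c * Real.exp (-β * u x)))) →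
        ∫ x, ‖x - xs‖ ^ 2 ∂μ ≤ 2 * d / (m * β) := by
  rintro β hβ μ hμ ⟨c, hc, hμc⟩
  have hd' : (1 : ℝ) ≤ d := by exact_mod_cast hd
  obtain ⟨s, hs⟩ : ∃ s : ℝ, s = 1 - 1 / (2 * d) := ⟨_, rfl⟩
  have hsd : (1 - s) * (2 * d) = 1 := by rw [hs]; field_simp; ring
  have hs1 : s < 1 := by nlinarith
  have hs2 : 1 / 2 ≤ s := by nlinarith
  have hpow : (1 : ℝ) / 2 ≤ s ^ d := by
    have h := one_add_mul_le_pow (a := s - 1) (by linarith) d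
    rw [add_sub_cancel] at h
    linarith
  have hucont : Continuous u := hu.continuous
  set ρ : EuclideanSpace ℝ (Fin d) → ENNReal :=
    fun x => ENNReal.ofReal (c * Real.exp (-β * u x)) with hρ
  have hρm : Measurable ρ := (Continuous.measurable (by fun_prop)).ennreal_ofReal
  have hmass : ∫⁻ x, ρ x = 1 := by
    rw [← setLIntegral_univ, ← withDensity_apply _ MeasurableSet.univ, ← hμc, measure_univ]
  set k : ℝ := β * (m * (1 - s)) with hk
  have hk0 : 0 < k := by have := sub_pos.2 hs1; positivity
  set q : EuclideanSpace ℝ (Fin d) → ENNReal :=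
    fun x => ENNReal.ofReal (k * ‖x - xs‖ ^ 2) with hq
  have hqm : Measurable q := (Continuous.measurable (by fun_prop)).ennreal_ofReal
  have hpoint : ∀ x, ρ x * (1 + q x) ≤ ρ (xs + s • (x - xs)) := by
    intro x
    have hgrow := add_sq_le_of_strongly_monotone_gradient hm (hu.differentiable (by norm_num))
      hA1 hxs hs2 hs1 x
    rw [hρ, hq, ← ENNReal.ofReal_one, ← ENNReal.ofReal_add zero_le_one (by positivity),
      ← ENNReal.ofReal_mul (by positivity)]
    refine ENNReal.ofReal_le_ofReal ?_
    calc c * Real.exp (-β * u x) * (1 + k * ‖x - xs‖ ^ 2)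
        ≤ c * Real.exp (-β * u x) * Real.exp (k * ‖x - xs‖ ^ 2) := by
          gcongr
          linarith [Real.add_one_le_exp (k * ‖x - xs‖ ^ 2)]
      _ = c * Real.exp (-β * u x + k * ‖x - xs‖ ^ 2) := by rw [Real.exp_add]; ring
      _ ≤ c * Real.exp (-β * u (xs + s • (x - xs))) := by
          gcongr
          rw [hk]
          nlinarith [mul_le_mul_of_nonneg_left hgrow hβ.le]
  have hbound : 1 + ∫⁻ x, q x ∂μ ≤ 1 + 1 := by
    calc 1 + ∫⁻ x, q x ∂μ = ∫⁻ x, (1 + q x) ∂μ := by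
          rw [lintegral_add_left measurable_const]; simp
      _ = ∫⁻ x, ρ x * (1 + q x) := by
          rw [hμc, lintegral_withDensity_eq_lintegral_mul _ hρm (by fun_prop)]; rfl
      _ ≤ ∫⁻ x, ρ (xs + s • (x - xs)) := lintegral_mono hpoint
      _ = ENNReal.ofReal ((s ^ d)⁻¹) := by
          rw [lintegral_comp_homothety volume (by linarith) xs hρm, hmass, mul_one,
            finrank_euclideanSpace_fin]
      _ ≤ ENNReal.ofReal 2 := by
          refine ENNReal.ofReal_le_ofReal ?_
          rw [inv_le_comm₀ (by linarith) two_pos]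
          linarith
      _ = 1 + 1 := by norm_num
  have hq1 : ∫⁻ x, q x ∂μ ≤ 1 := (ENNReal.add_le_add_iff_left ENNReal.one_ne_top).1 hbound
  have hint : k * ∫ x, ‖x - xs‖ ^ 2 ∂μ ≤ 1 := by
    rw [← integral_const_mul, integral_eq_lintegral_of_nonneg_ae
      (Filter.Eventually.of_forall fun x => by positivity)
      (Continuous.aestronglyMeasurable (by fun_prop))]
    simpa using ENNReal.toReal_mono ENNReal.one_ne_top hq1
  rw [le_div_iff₀ (by positivity)]
  calc (∫ x, ‖x - xs‖ ^ 2 ∂μ) * (m * β)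
      = (k * ∫ x, ‖x - xs‖ ^ 2 ∂μ) * (2 * d) := by
        rw [hk]; linear_combination (-(∫ x, ‖x - xs‖ ^ 2 ∂μ) * (m * β)) * hsd
    _ ≤ 1 * (2 * d) := by gcongr
    _ = 2 * d := one_mul _
end
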